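/- arXiv:2307.14513 — 3 statements merged into one kernel-verified Lean document; each statement's English description precedes it below -/
import Mathlib

section
/- Let $(R,\mathfrak{m})$ be a commutative Noetherian local domain of Krull dimension $2$ such that $H^1_{\mathfrak{m}}(R)$ is not a finitely generated $R$-module, and let $x$ be a nonzero element of $\mathfrak{m}$. Then $\dim R/(Rx + \operatorname{Ann}_R(H^1_{\mathfrak{m}}(R))) = 1$ while $\dim_R H^1_{\mathfrak{m}}(R) = 0$; in particular, $\dim R/(Rx + \operatorname{Ann}_R(H^1_{\mathfrak{m}}(R))) \neq \dim_R H^1_{\mathfrak{m}}(R)$. -/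
open CategoryTheory

noncomputable section

/-- The Krull dimension of an `R`-module `M`: the supremum of `dim R/𝔭` over
the primes `𝔭` in the support of `M`. -/
def moduleDim (R : Type) [CommRing R] (M : Type) [AddCommGroup M] [Module R M] :
    WithBot ℕ∞ :=
  ⨆ p ∈ Module.support R M, ringKrullDim (R ⧸ p.asIdeal)

section ExtOne
universe u
open Opposite Limits
variable {R : Type u} [CommRing R] {X : ModuleCat.{u} R}

/-- The complex `Hom(P, Y)`, with values in the opposite category, computing `Ext(X, Y)`. -/
def opHomComplex (P : ProjectiveResolution X) (Y : ModuleCat.{u} R) :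
    ChainComplex (ModuleCat.{u} R)ᵒᵖ ℕ :=
  ((((linearYoneda R (ModuleCat.{u} R)).obj Y).rightOp).mapHomologicalComplex _).obj P.complex

/-- The inclusion of the `1`-cocycles of `Hom(P, Y)`. -/
def cocycleInclusion (P : ProjectiveResolution X) (Y : ModuleCat.{u} R) :
    ((opHomComplex P Y).opcycles 1).unop ⟶ ModuleCat.of R (P.complex.X 1 ⟶ Y) :=
  ((opHomComplex P Y).pOpcycles 1).unop

/-- `Ext^1(X, Y)` as the first homology object of `opHomComplex P Y`. -/
def extOpIso (P : ProjectiveResolution X) (Y : ModuleCat.{u} R) :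
    op (((Ext R (ModuleCat.{u} R) 1).obj (op X)).obj Y) ≅ (opHomComplex P Y).homology 1 :=
  P.isoLeftDerivedObj ((linearYoneda R (ModuleCat.{u} R)).obj Y).rightOp 1

/-- The projection from the `1`-cocycles of `Hom(P, Y)` to `Ext^1(X, Y)`. -/
def cocycleClass (P : ProjectiveResolution X) (Y : ModuleCat.{u} R) :
    ((opHomComplex P Y).opcycles 1).unop ⟶ ((Ext R (ModuleCat.{u} R) 1).obj (op X)).obj Y :=
  ((opHomComplex P Y).homologyι 1).unop ≫ (extOpIso P Y).hom.unop

/-- The cocycle `c` represents the class `e` in `Ext^1(X, Y)`. -/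
def RepresentsExtOne (P : ProjectiveResolution X) {Y : ModuleCat.{u} R} (c : P.complex.X 1 ⟶ Y)
    (e : ((Ext R (ModuleCat.{u} R) 1).obj (op X)).obj Y) : Prop :=
  ∃ z, cocycleInclusion P Y z = c ∧ cocycleClass P Y z = e

variable (P : ProjectiveResolution X) {Y : ModuleCat.{u} R}

instance : Mono (cocycleInclusion P Y) :=
  unop_mono_of_epi ((opHomComplex P Y).pOpcycles 1)

instance : Epi (cocycleClass P Y) := by
  have : Epi ((opHomComplex P Y).homologyι 1).unop := unop_epi_of_mono _
  have : Epi (extOpIso P Y).hom.unop := unop_epi_of_mono _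
  exact epi_comp _ _

lemma exists_representsExtOne (e : ((Ext R (ModuleCat.{u} R) 1).obj (op X)).obj Y) :
    ∃ c, RepresentsExtOne P c e := by
  obtain ⟨z, hz⟩ := (ModuleCat.epi_iff_surjective (cocycleClass P Y)).mp inferInstance e
  exact ⟨_, z, rfl, hz⟩

variable {P}

lemma RepresentsExtOne.unique {c : P.complex.X 1 ⟶ Y}
    {e e' : ((Ext R (ModuleCat.{u} R) 1).obj (op X)).obj Y}
    (h : RepresentsExtOne P c e) (h' : RepresentsExtOne P c e') : e = e' := by
  obtain ⟨z, rfl, rfl⟩ := h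
  obtain ⟨z', hz, rfl⟩ := h'
  rw [(ModuleCat.mono_iff_injective (cocycleInclusion P Y)).mp inferInstance hz]

lemma RepresentsExtOne.add {c c' : P.complex.X 1 ⟶ Y}
    {e e' : ((Ext R (ModuleCat.{u} R) 1).obj (op X)).obj Y}
    (h : RepresentsExtOne P c e) (h' : RepresentsExtOne P c' e') :
    RepresentsExtOne P (c + c') (e + e') := by
  obtain ⟨z, rfl, rfl⟩ := h
  obtain ⟨z', rfl, rfl⟩ := h'
  exact ⟨z + z', map_add _ _ _, map_add _ _ _⟩

lemma RepresentsExtOne.smul {c : P.complex.X 1 ⟶ Y}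
    {e : ((Ext R (ModuleCat.{u} R) 1).obj (op X)).obj Y} (r : R)
    (h : RepresentsExtOne P c e) : RepresentsExtOne P (r • c) (r • e) := by
  obtain ⟨z, rfl, rfl⟩ := h
  exact ⟨r • z, map_smul (cocycleInclusion P Y).hom _ _, map_smul (cocycleClass P Y).hom _ _⟩

lemma exists_representsExtOne_iff {c : P.complex.X 1 ⟶ Y} :
    (∃ e, RepresentsExtOne P c e) ↔ P.complex.d 2 1 ≫ c = 0 := by
  let S : ShortComplex (ModuleCat.{u} R)ᵒᵖ := .mk ((opHomComplex P Y).d 2 1)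
    ((opHomComplex P Y).pOpcycles 1) (by simp)
  have hS : S.Exact := S.exact_of_g_is_cokernel
    ((opHomComplex P Y).opcyclesIsCokernel 2 1 (by simp))
  have := (ShortComplex.moduleCat_exact_iff _).mp hS.unop
  constructor
  · rintro ⟨e, z, rfl, -⟩
    exact ConcreteCategory.congr_hom S.unop.zero z
  · intro h
    obtain ⟨z, hz⟩ := this c h
    exact ⟨_, z, hz, rfl⟩

lemma representsExtOne_zero_iff {c : P.complex.X 1 ⟶ Y} :
    RepresentsExtOne P c 0 ↔ ∃ b : P.complex.X 0 ⟶ Y, c = P.complex.d 1 0 ≫ b := by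
  let S : ShortComplex (ModuleCat.{u} R)ᵒᵖ := .mk ((opHomComplex P Y).homologyι 1)
    ((opHomComplex P Y).fromOpcycles 1 0) (by simp)
  have hS : S.Exact := S.exact_of_f_is_kernel
    ((opHomComplex P Y).homologyIsKernel 1 0 (by simp))
  have hex := (ShortComplex.moduleCat_exact_iff _).mp hS.unop
  have hd := congrArg Quiver.Hom.unop ((opHomComplex P Y).p_fromOpcycles 1 0)
  have hinj : Function.Injective (extOpIso P Y).hom.unop :=
    (ModuleCat.mono_iff_injective _).mp (unop_mono_of_epi (extOpIso P Y).hom)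
  constructor
  · rintro ⟨z, rfl, hz⟩
    obtain ⟨b, rfl⟩ := hex z (hinj (hz.trans (map_zero _).symm))
    exact ⟨b, ConcreteCategory.congr_hom hd b⟩
  · rintro ⟨b, rfl⟩
    refine ⟨((opHomComplex P Y).fromOpcycles 1 0).unop b, ConcreteCategory.congr_hom hd b, ?_⟩
    exact (congrArg (extOpIso P Y).hom.unop
      (ConcreteCategory.congr_hom S.unop.zero b)).trans (map_zero _)

lemma RepresentsExtOne.comp {X' : ModuleCat.{u} R} {P' : ProjectiveResolution X'} (f : X' ⟶ X)
    {c : P.complex.X 1 ⟶ Y} {e : ((Ext R (ModuleCat.{u} R) 1).obj (op X)).obj Y}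
    (h : RepresentsExtOne P c e) (φ : P'.complex ⟶ P.complex)
    (comm : φ.f 0 ≫ P.π.f 0 = P'.π.f 0 ≫ f) :
    RepresentsExtOne P' (φ.f 1 ≫ c) (((Ext R (ModuleCat.{u} R) 1).map f.op).app Y e) := by
  let F := ((linearYoneda R (ModuleCat.{u} R)).obj Y).rightOp
  let ψ : opHomComplex P' Y ⟶ opHomComplex P Y := (F.mapHomologicalComplex _).map φ
  obtain ⟨z, rfl, rfl⟩ := h
  have h₁ := congrArg Quiver.Hom.unop (HomologicalComplex.p_opcyclesMap ψ 1)
  have h₂ := congrArg Quiver.Hom.unop (HomologicalComplex.homologyι_naturality ψ 1)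
  have h₃ := congrArg Quiver.Hom.unop
    (ProjectiveResolution.isoLeftDerivedObj_hom_naturality f P' P φ comm F 1)
  refine ⟨(HomologicalComplex.opcyclesMap ψ 1).unop z, ?_, ?_⟩
  · exact ConcreteCategory.congr_hom h₁ z
  · have h₄ := (congrArg (fun k => k ≫ (extOpIso P' Y).hom.unop) h₂).symm.trans
      (congrArg (fun k => ((opHomComplex P Y).homologyι 1).unop ≫ k) h₃).symm
    exact ConcreteCategory.congr_hom h₄ z

/-- The augmentation of a projective resolution of a module. -/
def augmentation (P : ProjectiveResolution X) : P.complex.X 0 ⟶ X := P.π.f 0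

lemma smul_extOne_eq_zero {e : ((Ext R (ModuleCat.{u} R) 1).obj (op X)).obj Y} {r : R}
    (hr : ∀ x : X, r • x = 0) : r • e = 0 := by
  let P := projectiveResolution X
  obtain ⟨c, hc⟩ := exists_representsExtOne P e
  have hrX : r • 𝟙 X = 0 := by ext x; exact hr x
  have h₀ : (r • 𝟙 (P.complex.X 0)) ≫ augmentation P = 0 := by
    rw [Linear.smul_comp, Category.id_comp, ← Category.comp_id (augmentation P),
      ← Linear.comp_smul, hrX, comp_zero]
  let s : P.complex.X 0 ⟶ P.complex.X 1 := P.exact₀.liftFromProjective _ h₀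
  have hs : s ≫ P.complex.d 1 0 = r • 𝟙 _ := P.exact₀.liftFromProjective_comp _ h₀
  have h₁ : (r • 𝟙 (P.complex.X 1) - P.complex.d 1 0 ≫ s) ≫ P.complex.d 1 0 = 0 := by
    rw [Preadditive.sub_comp, Category.assoc, hs]
    simp
  let t : P.complex.X 1 ⟶ P.complex.X 2 := (P.exact_succ 0).liftFromProjective _ h₁
  have ht : t ≫ P.complex.d 2 1 = r • 𝟙 (P.complex.X 1) - P.complex.d 1 0 ≫ s :=
    (P.exact_succ 0).liftFromProjective_comp _ h₁
  refine (hc.smul r).unique (representsExtOne_zero_iff.mpr ⟨s ≫ c, ?_⟩)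
  have h₂ : t ≫ P.complex.d 2 1 ≫ c = 0 := by
    rw [exists_representsExtOne_iff.mp ⟨e, hc⟩, comp_zero]
  rw [← Category.assoc, ht, Preadditive.sub_comp, sub_eq_zero] at h₂
  simpa using h₂

section Connecting
variable {r : R}

lemma exists_eq_smul_of_comp_mkQ_eq_zero [IsDomain R] (hr : r ≠ 0) {M : ModuleCat.{u} R}
    (g : M ⟶ ModuleCat.of R R)
    (hg : g ≫ ModuleCat.ofHom (Submodule.mkQ (Ideal.span {r})) = 0) :
    ∃ h : M ⟶ ModuleCat.of R R, g = r • h := by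
  have key (m : M) : ∃ y : R, r * y = g m := by
    have := ConcreteCategory.congr_hom hg m
    have : g m ∈ Ideal.span {r} := (Submodule.Quotient.mk_eq_zero _).mp this
    obtain ⟨y, hy⟩ := Ideal.mem_span_singleton'.mp this
    exact ⟨y, by rw [mul_comm, hy]⟩
  choose y hy using key
  refine ⟨ModuleCat.ofHom ⟨⟨y, fun a b => mul_left_cancel₀ hr ?_⟩,
    fun a b => mul_left_cancel₀ hr ?_⟩, ?_⟩
  · rw [mul_add, hy, hy, hy, map_add]
  · rw [hy, map_smul]
    change a * g b = r * (a * y b)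
    rw [← hy]; ring
  · ext m
    exact (hy m).symm

/-- `f : X ⟶ R/(r)` is sent to `e` by the connecting map `Hom(X, R/(r)) ⟶ Ext^1(X, R)` of
`0 ⟶ R ⟶ R ⟶ R/(r) ⟶ 0`. -/
def Connects (P : ProjectiveResolution X) (f : X ⟶ ModuleCat.of R (R ⧸ Ideal.span {r}))
    (e : ((Ext R (ModuleCat.{u} R) 1).obj (op X)).obj (ModuleCat.of R R)) : Prop :=
  ∃ (b : P.complex.X 0 ⟶ ModuleCat.of R R) (c : P.complex.X 1 ⟶ ModuleCat.of R R),
    augmentation P ≫ f =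
      b ≫ ModuleCat.ofHom (Submodule.mkQ (Ideal.span {r})) ∧
    r • c = P.complex.d 1 0 ≫ b ∧ RepresentsExtOne P c e

variable {P : ProjectiveResolution X} {f f' : X ⟶ ModuleCat.of R (R ⧸ Ideal.span {r})}
  {e e' : ((Ext R (ModuleCat.{u} R) 1).obj (op X)).obj (ModuleCat.of R R)}

lemma Connects.add (h : Connects P f e) (h' : Connects P f' e') :
    Connects P (f + f') (e + e') := by
  obtain ⟨b, c, h₁, h₂, h₃⟩ := h
  obtain ⟨b', c', h₁', h₂', h₃'⟩ := h'
  exact ⟨b + b', c + c', by rw [Preadditive.comp_add, h₁, h₁', Preadditive.add_comp],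
    by rw [smul_add, h₂, h₂', Preadditive.comp_add], h₃.add h₃'⟩

lemma Connects.smul (a : R) (h : Connects P f e) : Connects P (a • f) (a • e) := by
  obtain ⟨b, c, h₁, h₂, h₃⟩ := h
  exact ⟨a • b, a • c, by rw [Linear.comp_smul, h₁, Linear.smul_comp],
    by rw [smul_comm, h₂, Linear.comp_smul], h₃.smul a⟩

lemma Connects.comp {X' : ModuleCat.{u} R} {P' : ProjectiveResolution X'} (g : X' ⟶ X)
    (h : Connects P f e) :
    Connects P' (g ≫ f) (((Ext R (ModuleCat.{u} R) 1).map g.op).app _ e) := by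
  obtain ⟨b, c, h₁, h₂, h₃⟩ := h
  let φ := ProjectiveResolution.lift g P' P
  have hφ : φ.f 0 ≫ P.π.f 0 = P'.π.f 0 ≫ g := ProjectiveResolution.lift_commutes_zero g P' P
  refine ⟨φ.f 0 ≫ b, φ.f 1 ≫ c, ?_, ?_, h₃.comp g φ hφ⟩
  · rw [Category.assoc, ← h₁]
    exact (congrArg (· ≫ f) hφ).symm
  · rw [← Linear.comp_smul, h₂, ← Category.assoc, ← Category.assoc, φ.comm]

lemma smul_hom_cancel [IsDomain R] (hr : r ≠ 0) {M : ModuleCat.{u} R}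
    {g h : M ⟶ ModuleCat.of R R} (H : r • g = r • h) : g = h := by
  ext m
  exact mul_left_cancel₀ hr (ConcreteCategory.congr_hom H m)

lemma Connects.eq_zero [IsDomain R] (hr : r ≠ 0)
    (h : Connects P (0 : X ⟶ ModuleCat.of R (R ⧸ Ideal.span {r})) e) : e = 0 := by
  obtain ⟨b, c, h₁, h₂, h₃⟩ := h
  rw [comp_zero] at h₁
  obtain ⟨b', rfl⟩ := exists_eq_smul_of_comp_mkQ_eq_zero hr b h₁.symm
  rw [Linear.comp_smul] at h₂
  exact h₃.unique (representsExtOne_zero_iff.mpr ⟨b', smul_hom_cancel hr h₂⟩)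

lemma Connects.unique [IsDomain R] (hr : r ≠ 0) (h : Connects P f e)
    (h' : Connects P f e') : e = e' := by
  have := h.add (h'.smul (-1))
  rw [neg_one_smul, neg_one_smul, add_neg_cancel] at this
  exact eq_of_sub_eq_zero ((sub_eq_add_neg e e').trans (this.eq_zero hr))

lemma exists_connects_of_hom [IsDomain R] (hr : r ≠ 0) (P : ProjectiveResolution X)
    (f : X ⟶ ModuleCat.of R (R ⧸ Ideal.span {r})) : ∃ e, Connects P f e := by
  let q : ModuleCat.of R R ⟶ ModuleCat.of R (R ⧸ Ideal.span {r}) :=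
    ModuleCat.ofHom (Submodule.mkQ (Ideal.span {r}))
  have : Epi q := (ModuleCat.epi_iff_surjective _).mpr (Submodule.mkQ_surjective _)
  let b := Projective.factorThru (augmentation P ≫ f) q
  have hb : b ≫ q = augmentation P ≫ f := Projective.factorThru_comp _ _
  have hdb : (P.complex.d 1 0 ≫ b) ≫ q = 0 := by
    rw [Category.assoc, hb, ← Category.assoc]
    exact (congrArg (· ≫ f) P.complex_d_comp_π_f_zero).trans zero_comp
  obtain ⟨c, hc⟩ := exists_eq_smul_of_comp_mkQ_eq_zero hr _ hdb
  obtain ⟨e, he⟩ := (exists_representsExtOne_iff (P := P) (c := c)).mpr (by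
    refine smul_hom_cancel hr ?_
    rw [← Linear.comp_smul, ← hc]
    simp)
  exact ⟨e, b, c, hb.symm, hc.symm, he⟩

lemma exists_connects_of_smul_eq_zero (P : ProjectiveResolution X)
    (e : ((Ext R (ModuleCat.{u} R) 1).obj (op X)).obj (ModuleCat.of R R)) (he : r • e = 0) :
    ∃ f : X ⟶ ModuleCat.of R (R ⧸ Ideal.span {r}), Connects P f e := by
  let q : ModuleCat.of R R ⟶ ModuleCat.of R (R ⧸ Ideal.span {r}) :=
    ModuleCat.ofHom (Submodule.mkQ (Ideal.span {r}))
  obtain ⟨c, hc⟩ := exists_representsExtOne P e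
  obtain ⟨b, hb⟩ := representsExtOne_zero_iff.mp (he ▸ hc.smul r)
  have hq : P.complex.d 1 0 ≫ b ≫ q = 0 := by
    rw [← Category.assoc, ← hb]
    ext m
    exact (Submodule.Quotient.mk_eq_zero _).mpr
      (Ideal.mul_mem_right _ _ (Ideal.mem_span_singleton_self r))
  exact ⟨P.exact₀.desc (b ≫ q) hq, b, c, P.exact₀.g_desc _ hq, hb, hc⟩

end Connecting
end ExtOne

namespace localCohomology
universe u
open Opposite Limits
variable {R : Type u} [CommRing R] (J : Ideal R)

/-- The module `R/J^n`. -/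
abbrev quotPow (n : ℕ) : ModuleCat.{u} R := ModuleCat.of R (R ⧸ J ^ n)

/-- The projection `R/J^k ⟶ R/J^n` for `n ≤ k`. -/
def quotPowMap {n k : ℕ} (h : n ≤ k) : quotPow J k ⟶ quotPow J n :=
  ModuleCat.ofHom (Submodule.mapQ (J ^ k) (J ^ n) LinearMap.id (Ideal.pow_le_pow_right h))

/-- The `R`-module `Ext^i(R/J^n, M)`. -/
abbrev extPow (i n : ℕ) (M : ModuleCat.{u} R) : ModuleCat.{u} R :=
  ((Ext R (ModuleCat.{u} R) i).obj (op (quotPow J n))).obj M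

/-- The transition map `Ext^i(R/J^n, M) ⟶ Ext^i(R/J^k, M)` for `n ≤ k`. -/
def extPowMap (i : ℕ) {n k : ℕ} (h : n ≤ k) (M : ModuleCat.{u} R) :
    extPow J i n M ⟶ extPow J i k M :=
  ((Ext R (ModuleCat.{u} R) i).map (quotPowMap J h).op).app M

/-- The canonical map from `Ext^i(R/J^n, M)` to local cohomology. -/
def ofExtPow (i n : ℕ) (M : ModuleCat.{u} R) :
    extPow J i n M ⟶ (localCohomology J i).obj M :=
  (colimit.ι (diagram (idealPowersDiagram J) i) (op (op n))).app M

variable {J} {i : ℕ} {M : ModuleCat.{u} R}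

lemma ofExtPow_extPowMap {n k : ℕ} (h : n ≤ k) (e : extPow J i n M) :
    ofExtPow J i k M (extPowMap J i h M e) = ofExtPow J i n M e := by
  have := congrArg (fun t => t.app M) (colimit.w (diagram (idealPowersDiagram J) i)
    (homOfLE h).op.op)
  exact ConcreteCategory.congr_hom this e

instance : PreservesColimitsOfShape (ℕᵒᵖ)ᵒᵖ (forget (ModuleCat.{u} R)) :=
  have : PreservesFilteredColimitsOfSize.{0, 0} (forget (ModuleCat.{u} R)) :=
    preservesFilteredColimitsOfSize_shrink.{0, u, 0, u} _
  inferInstance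

lemma exists_ofExtPow_eq (x : (localCohomology J i).obj M) :
    ∃ n e, ofExtPow J i n M e = x := by
  obtain ⟨j, y, hy⟩ := Concrete.isColimit_exists_rep _
    (isColimitOfPreserves ((evaluation _ _).obj M)
      (colimit.isColimit (diagram (idealPowersDiagram J) i))) x
  exact ⟨j.unop.unop, y, hy⟩

lemma exists_extPowMap_eq_zero {n : ℕ} {e : extPow J i n M} (he : ofExtPow J i n M e = 0) :
    ∃ k, ∃ h : n ≤ k, extPowMap J i h M e = 0 := by
  obtain ⟨j, f, hf⟩ := (IsColimit.eq_iff'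
    (isColimitOfPreserves ((evaluation _ _).obj M)
      (colimit.isColimit (diagram (idealPowersDiagram J) i))) (i := op (op n)) e 0).mp
    (he.trans (map_zero (ofExtPow J i n M).hom).symm)
  have h : n ≤ j.unop.unop := leOfHom f.unop.unop
  exact ⟨j.unop.unop, h, hf.trans (map_zero (extPowMap J i h M).hom)⟩

lemma exists_forall_mem_pow_smul_eq_zero (x : (localCohomology J 1).obj M) :
    ∃ n, ∀ r ∈ J ^ n, r • x = 0 := by
  obtain ⟨n, e, rfl⟩ := exists_ofExtPow_eq x
  refine ⟨n, fun r hr => ?_⟩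
  rw [← map_smul, smul_extOne_eq_zero, map_zero]
  intro y
  obtain ⟨y, rfl⟩ := Submodule.mkQ_surjective _ y
  exact (Submodule.Quotient.mk_eq_zero _).mpr (Ideal.mul_mem_right _ _ hr)

lemma exists_hom_factor [IsNoetherianRing R] (N : ModuleCat.{u} R) [Module.Finite R N] :
    ∃ n, ∀ k (h : n ≤ k) (f : quotPow J k ⟶ N), ∃ g, f = quotPowMap J h ≫ g := by
  let T : ℕ →o Submodule R N :=
    ⟨fun n => Submodule.torsionBySet R N (J ^ n : Ideal R), fun a b hab =>
      Submodule.torsionBySet_le_torsionBySet_of_subset (Ideal.pow_le_pow_right hab)⟩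
  obtain ⟨n, hn⟩ := monotone_stabilizes_iff_noetherian.mpr
    (inferInstanceAs (IsNoetherian R N)) T
  refine ⟨n, fun k h f => ?_⟩
  have hf : f (Submodule.mkQ (J ^ k) 1) ∈ T k := by
    refine (Submodule.mem_torsionBySet_iff _ _).mpr ?_
    rintro ⟨a, ha⟩
    change a • f (Submodule.mkQ (J ^ k) 1) = 0
    rw [← map_smul, ← map_smul, show Submodule.mkQ (J ^ k) (a • 1) = 0 from
      (Submodule.Quotient.mk_eq_zero _).mpr (by simpa using ha), map_zero]
  rw [← hn k h] at hf
  refine ⟨ModuleCat.ofHom (Submodule.liftQ (J ^ n)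
    (LinearMap.toSpanSingleton R N (f (Submodule.mkQ (J ^ k) 1))) ?_), ?_⟩
  · intro a ha
    exact (Submodule.mem_torsionBySet_iff _ _).mp hf ⟨a, ha⟩
  · refine ModuleCat.hom_ext (LinearMap.ext fun y => ?_)
    obtain ⟨y, rfl⟩ := Submodule.mkQ_surjective _ y
    change f (Submodule.mkQ (J ^ k) y) = y • f (Submodule.mkQ (J ^ k) 1)
    rw [← map_smul, ← map_smul, smul_eq_mul, mul_one]

lemma finite_of_smul_eq_zero [IsDomain R] [IsNoetherianRing R] {r : R} (hr : r ≠ 0)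
    (h : ∀ x : (localCohomology J 1).obj (ModuleCat.of R R), r • x = 0) :
    Module.Finite R ((localCohomology J 1).obj (ModuleCat.of R R)) := by
  let N := ModuleCat.of R (R ⧸ Ideal.span {r})
  have : Module.Finite R N := inferInstanceAs (Module.Finite R (R ⧸ Ideal.span {r}))
  obtain ⟨n, hn⟩ := exists_hom_factor (J := J) N
  let P (k : ℕ) := projectiveResolution (quotPow J k)
  choose δ hδ using fun f : quotPow J n ⟶ N => exists_connects_of_hom hr (P n) f
  let Δ : (quotPow J n ⟶ N) →ₗ[R] extPow J 1 n (ModuleCat.of R R) :=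
    { toFun := δ
      map_add' := fun f g => (hδ _).unique hr ((hδ f).add (hδ g))
      map_smul' := fun a f => (hδ _).unique hr ((hδ f).smul a) }
  have hfin : Module.Finite R (quotPow J n ⟶ N) :=
    Module.Finite.equiv (ModuleCat.homLinearEquiv (S := R)).symm
  refine Module.Finite.of_surjective ((ofExtPow J 1 n _).hom ∘ₗ Δ) fun x => ?_
  obtain ⟨m, e, rfl⟩ := exists_ofExtPow_eq x
  obtain ⟨k, hmk, hk⟩ := exists_extPowMap_eq_zero
    (e := extPowMap J 1 (le_max_left m n) _ (r • e)) (by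
      rw [ofExtPow_extPowMap, map_smul, h])
  have hk' : r • extPowMap J 1 hmk (ModuleCat.of R R)
      (extPowMap J 1 (le_max_left m n) _ e) = 0 := by
    rw [← hk, ← map_smul, ← map_smul]
  obtain ⟨f, hf⟩ := exists_connects_of_smul_eq_zero (P k) _ hk'
  have hnk : n ≤ k := (le_max_right m n).trans hmk
  obtain ⟨g, rfl⟩ := hn k hnk f
  refine ⟨g, ?_⟩
  change ofExtPow J 1 n _ (δ g) = _
  rw [← ofExtPow_extPowMap hnk, ← ofExtPow_extPowMap (le_max_left m n) e,
    ← ofExtPow_extPowMap hmk]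
  exact congrArg _ (((hδ g).comp (P' := P k) (quotPowMap J hnk)).unique hr hf)

lemma annihilator_eq_bot [IsDomain R] [IsNoetherianRing R]
    (hfg : ¬ Module.Finite R ((localCohomology J 1).obj (ModuleCat.of R R))) :
    Module.annihilator R ((localCohomology J 1).obj (ModuleCat.of R R)) = ⊥ := by
  by_contra h
  obtain ⟨r, hr, hr0⟩ := Submodule.exists_mem_ne_zero_of_ne_bot h
  exact hfg (finite_of_smul_eq_zero hr0 (Module.mem_annihilator.mp hr))

lemma support_subset_zeroLocus :
    Module.support R ((localCohomology J 1).obj M) ⊆ PrimeSpectrum.zeroLocus J := by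
  intro p hp
  obtain ⟨x, hx⟩ := Module.mem_support_iff_exists_annihilator.mp hp
  obtain ⟨n, hn⟩ := exists_forall_mem_pow_smul_eq_zero x
  refine Ideal.IsPrime.le_of_pow_le (n := n) (le_trans (fun r hr => ?_) hx)
  exact (Submodule.mem_annihilator_span_singleton _ _).mpr (hn r hr)

end localCohomology

lemma moduleDim_eq_zero_of_support_subset {R : Type} [CommRing R] [IsLocalRing R]
    {M : Type} [AddCommGroup M] [Module R M] [Nontrivial M]
    (h : Module.support R M ⊆ PrimeSpectrum.zeroLocus (IsLocalRing.maximalIdeal R)) :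
    moduleDim R M = 0 := by
  have hp (p) (hp : p ∈ Module.support R M) : ringKrullDim (R ⧸ p.asIdeal) = 0 := by
    rw [← (IsLocalRing.maximalIdeal.isMaximal R).eq_of_le p.isPrime.ne_top (h hp)]
    let := Ideal.Quotient.field (IsLocalRing.maximalIdeal R)
    exact ringKrullDim_eq_zero_of_field (R ⧸ IsLocalRing.maximalIdeal R)
  obtain ⟨p, hpM⟩ := Module.nonempty_support_of_nontrivial (R := R) (M := M)
  exact le_antisymm (iSup₂_le fun p hpM => (hp p hpM).le)
    ((hp p hpM).ge.trans (le_iSup₂_of_le p hpM le_rfl))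

/-- For a Noetherian local domain `(R, 𝔪)` of dimension `2` with `H^1_𝔪(R)` not finitely
generated and a nonzero `x ∈ 𝔪`: `dim R/(Rx + Ann H^1_𝔪(R)) = 1` while `dim H^1_𝔪(R) = 0`;
in particular these two numbers differ. -/
theorem dim_ne_of_localCohomology (R : Type) [CommRing R] [IsDomain R]
    [IsNoetherianRing R] [IsLocalRing R] (hdim : ringKrullDim R = 2)
    (hfg : ¬ Module.Finite R
      ((localCohomology (IsLocalRing.maximalIdeal R) 1).obj (ModuleCat.of R R)))
    (x : R) (hx0 : x ≠ 0) (hx : x ∈ IsLocalRing.maximalIdeal R) :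
    ringKrullDim (R ⧸ (Ideal.span {x} + Module.annihilator R
        ((localCohomology (IsLocalRing.maximalIdeal R) 1).obj (ModuleCat.of R R)))) = 1 ∧
      moduleDim R
        ((localCohomology (IsLocalRing.maximalIdeal R) 1).obj (ModuleCat.of R R)) = 0 ∧
      ringKrullDim (R ⧸ (Ideal.span {x} + Module.annihilator R
          ((localCohomology (IsLocalRing.maximalIdeal R) 1).obj (ModuleCat.of R R)))) ≠
        moduleDim R
          ((localCohomology (IsLocalRing.maximalIdeal R) 1).obj (ModuleCat.of R R)) := by
  have hann := localCohomology.annihilator_eq_bot hfg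
  have h₁ : ringKrullDim (R ⧸ (Ideal.span {x} + Module.annihilator R
      ((localCohomology (IsLocalRing.maximalIdeal R) 1).obj (ModuleCat.of R R)))) = 1 := by
    rw [hann, Submodule.add_eq_sup, sup_bot_eq]
    have h := ringKrullDim_quotient_span_singleton_succ_eq_ringKrullDim_of_mem_nonZeroDivisors
      (mem_nonZeroDivisors_of_ne_zero hx0) hx
    rw [hdim, ← one_add_one_eq_two] at h
    exact (ENat.WithBot.add_one_cancel).mp h
  have : Nontrivial ((localCohomology (IsLocalRing.maximalIdeal R) 1).obj (ModuleCat.of R R)) := by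
    by_contra h
    rw [not_nontrivial_iff_subsingleton] at h
    exact hfg inferInstance
  have h₂ := moduleDim_eq_zero_of_support_subset
    (localCohomology.support_subset_zeroLocus (J := IsLocalRing.maximalIdeal R)
      (M := ModuleCat.of R R))
  exact ⟨h₁, h₂, by rw [h₁, h₂]; exact one_ne_zero⟩
end
end

section
/- Let $(R,\mathfrak{m})$ be a commutative Noetherian complete local domain of Krull dimension $2$. Then $H^1_{\mathfrak{m}}(R)$ is a finitely generated $R$-module. Equivalently, a Noetherian local domain of dimension $2$ whose first local cohomology module $H^1_{\mathfrak{m}}(R)$ with respect to the maximal ideal is not finitely generated cannot be complete. -/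
open CategoryTheory

noncomputable section

open Opposite

namespace CategoryTheory.ShortComplex

lemma mono_homologyMap_of_unop {C : Type*} [Category* C] [Abelian C] {S T : ShortComplex Cᵒᵖ}
    (ψ : S ⟶ T) [Epi (homologyMap (unopMap ψ))] : Mono (homologyMap ψ) := by
  have : Mono (homologyMap (opMap (unopMap ψ)) ≫ T.unop.homologyOpIso.hom) := by
    rw [homologyOpIso_hom_naturality (unopMap ψ)]
    infer_instance
  exact mono_of_mono (homologyMap (opMap (unopMap ψ))) T.unop.homologyOpIso.hom

variable {R : Type*} [Ring R] {S T : ShortComplex (ModuleCat R)}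

lemma exists_iCycles_eq {y : S.X₂} (hy : S.g y = 0) : ∃ c : S.cycles, S.iCycles c = y :=
  ⟨S.moduleCatCyclesIso.inv ⟨y, hy⟩, congr($(S.moduleCatCyclesIso_inv_iCycles) ⟨y, hy⟩)⟩

lemma homologyπ_surjective : Function.Surjective S.homologyπ :=
  (ModuleCat.epi_iff_surjective S.homologyπ).1 inferInstance

lemma iCycles_injective : Function.Injective S.iCycles :=
  (ModuleCat.mono_iff_injective S.iCycles).1 inferInstance

lemma g_iCycles (c : S.cycles) : S.g (S.iCycles c) = 0 :=
  congr($(S.iCycles_g) c)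

lemma homologyπ_toCycles (b : S.X₁) : S.homologyπ (S.toCycles b) = 0 :=
  congr($(S.toCycles_comp_homologyπ) b)

lemma epi_homologyMap_of_forall_cycle (ψ : S ⟶ T)
    (h : ∀ z : T.X₂, T.g z = 0 →
      ∃ y : S.X₂, S.g y = 0 ∧ ∃ b : T.X₁, z = ψ.τ₂ y + T.f b) :
    Epi (homologyMap ψ) := by
  rw [ModuleCat.epi_iff_surjective]
  intro t
  obtain ⟨c, rfl⟩ := homologyπ_surjective t
  obtain ⟨y, hy, b, hb⟩ := h (T.iCycles c) (g_iCycles c)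
  obtain ⟨c', hc'⟩ := exists_iCycles_eq hy
  refine ⟨S.homologyπ c', ?_⟩
  have hc : c = cyclesMap ψ c' + T.toCycles b := by
    apply iCycles_injective
    rw [hb, map_add, ← hc']
    exact congr($(cyclesMap_i ψ).hom c' + $(T.toCycles_i).hom b).symm
  rw [hc, map_add, homologyπ_toCycles, add_zero]
  exact congr($(homologyπ_naturality ψ) c')

lemma finite_homology {M : Type*} [AddCommGroup M] [Module R M] [Module.Finite R M]
    (l : M →ₗ[R] S.X₂) (hl : ∀ m, S.g (l m) = 0)
    (h : ∀ z : S.X₂, S.g z = 0 → ∃ m, ∃ b : S.X₁, z = l m + S.f b) :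
    Module.Finite R S.homology := by
  refine Module.Finite.of_surjective (S.homologyπ.hom ∘ₗ S.moduleCatCyclesIso.inv.hom ∘ₗ
    l.codRestrict (LinearMap.ker S.g.hom) hl) fun t ↦ ?_
  obtain ⟨c, rfl⟩ := homologyπ_surjective t
  obtain ⟨m, b, hb⟩ := h (S.iCycles c) (g_iCycles c)
  refine ⟨m, ?_⟩
  have hc : c = S.moduleCatCyclesIso.inv ⟨l m, hl m⟩ + S.toCycles b := by
    apply iCycles_injective
    rw [hb, map_add]
    exact congr($(S.moduleCatCyclesIso_inv_iCycles).hom ⟨l m, hl m⟩ + $(S.toCycles_i).hom b).symm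
  rw [hc, map_add, homologyπ_toCycles, add_zero]
  rfl

end CategoryTheory.ShortComplex

section
variable {R : Type} [CommRing R]

/-- The short complex `Hom(P₀, Y) ⟶ Hom(P₁, Y) ⟶ Hom(P₂, Y)`. -/
abbrev homShortComplex (Y : ModuleCat.{0} R) :
    ChainComplex (ModuleCat.{0} R) ℕ ⥤ ShortComplex (ModuleCat.{0} R)ᵒᵖ :=
  (((linearYoneda R (ModuleCat.{0} R)).obj Y).rightOp.mapHomologicalComplex _) ⋙
      (HomologicalComplex.shortComplexFunctor' _ (ComplexShape.down ℕ) 2 1 0)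

lemma epi_Ext_map {X X' : ModuleCat.{0} R} (g : X' ⟶ X) (Y : ModuleCat.{0} R)
    (P : ProjectiveResolution X) (P' : ProjectiveResolution X') (φ : P'.complex ⟶ P.complex)
    (comm : φ.f 0 ≫ P.π.f 0 = P'.π.f 0 ≫ g)
    [Epi (ShortComplex.homologyMap (ShortComplex.unopMap ((homShortComplex Y).map φ)))] :
    Epi (((Ext R (ModuleCat R) 1).map g.op).app Y) := by
  set F := ((linearYoneda R (ModuleCat R)).obj Y).rightOp
  suffices Mono ((F.leftDerived 1).map g) from
    inferInstanceAs (Epi ((F.leftDerived 1).map g).unop)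
  have h0 := ShortComplex.mono_homologyMap_of_unop ((homShortComplex Y).map φ)
  let α := Functor.isoWhiskerRight (HomologicalComplex.natIsoSc' (ModuleCat R)ᵒᵖ
    (ComplexShape.down ℕ) 2 1 0 (by simp) (by simp)) (ShortComplex.homologyFunctor _)
  have h1 : Mono ((HomologicalComplex.homologyFunctor _ _ 1).map
      ((F.mapHomologicalComplex _).map φ)) := by
    have := α.hom.naturality ((F.mapHomologicalComplex _).map φ)
    have h2 : Mono ((HomologicalComplex.homologyFunctor _ _ 1).map
        ((F.mapHomologicalComplex _).map φ) ≫ α.hom.app _) := by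
      refine (congrArg Mono this).mpr ?_
      refine @mono_comp _ _ _ _ _ _ _ _ h0
    exact mono_of_mono _ (α.hom.app _)
  have h2 := ProjectiveResolution.isoLeftDerivedObj_hom_naturality g P' P φ comm F 1
  have : Mono ((F.leftDerived 1).map g ≫ (P.isoLeftDerivedObj F 1).hom) := by
    rw [h2]
    exact @mono_comp _ _ _ _ _ _ _ _ h1
  exact mono_of_mono _ (P.isoLeftDerivedObj F 1).hom

lemma finite_Ext {X : ModuleCat.{0} R} (Y : ModuleCat.{0} R) (P : ProjectiveResolution X)
    [Module.Finite R ((homShortComplex Y).obj P.complex).unop.homology] :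
    Module.Finite R (((Ext R (ModuleCat R) 1).obj (op X)).obj Y) := by
  set F := ((linearYoneda R (ModuleCat R)).obj Y).rightOp
  let α := Functor.isoWhiskerRight (HomologicalComplex.natIsoSc' (ModuleCat R)ᵒᵖ
    (ComplexShape.down ℕ) 2 1 0 (by simp) (by simp)) (ShortComplex.homologyFunctor _)
  let e : (F.leftDerived 1).obj X ≅ op (((homShortComplex Y).obj P.complex).unop.homology) :=
    P.isoLeftDerivedObj F 1 ≪≫ α.app _ ≪≫ ((homShortComplex Y).obj P.complex).unop.homologyOpIso
  exact Module.Finite.equiv e.unop.toLinearEquiv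
end

section Cocycle

variable {R : Type*} [CommRing R] {J : Ideal R} {P₀ P₁ Y : Type*} [AddCommGroup P₀] [Module R P₀]
  [AddCommGroup P₁] [Module R P₁] [AddCommGroup Y] [Module R Y]

lemma exists_lift_mkQ [Module.Projective R P₀] (ε : P₀ →ₗ[R] R ⧸ J) :
    ∃ π : P₀ →ₗ[R] R, J.mkQ ∘ₗ π = ε :=
  Module.projective_lifting_property _ _ J.mkQ_surjective

lemma apply_mem_of_exact {d : P₁ →ₗ[R] P₀} {ε : P₀ →ₗ[R] R ⧸ J} (hdε : Function.Exact d ε)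
    {π : P₀ →ₗ[R] R} (hπ : J.mkQ ∘ₗ π = ε) (p : P₁) : π (d p) ∈ J := by
  rw [← Ideal.Quotient.eq_zero_iff_mem]
  exact (LinearMap.congr_fun hπ (d p)).trans (hdε.apply_apply_eq_zero p)

/-- The comparison map from `P₁` to `J` induced by a lift `π` of the augmentation. -/
def toIdeal {d : P₁ →ₗ[R] P₀} {ε : P₀ →ₗ[R] R ⧸ J} (hdε : Function.Exact d ε)
    {π : P₀ →ₗ[R] R} (hπ : J.mkQ ∘ₗ π = ε) : P₁ →ₗ[R] J :=
  (π ∘ₗ d).codRestrict J (apply_mem_of_exact hdε hπ)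

lemma exists_eq_toIdeal_add {d : P₁ →ₗ[R] P₀} {ε : P₀ →ₗ[R] R ⧸ J} (hdε : Function.Exact d ε)
    (hε : Function.Surjective ε) {π : P₀ →ₗ[R] R} (hπ : J.mkQ ∘ₗ π = ε)
    (z : P₁ →ₗ[R] Y) (hz : LinearMap.ker d ≤ LinearMap.ker z) :
    ∃ (f : J →ₗ[R] Y) (b : P₀ →ₗ[R] Y), z = f ∘ₗ toIdeal hdε hπ + b ∘ₗ d := by
  obtain ⟨p₀, hp₀⟩ := hε (J.mkQ 1)
  let σ : R →ₗ[R] P₀ := LinearMap.toSpanSingleton R P₀ p₀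
  have hσ (r : R) : ε (σ r) = J.mkQ r := by
    simp only [σ, LinearMap.toSpanSingleton_apply, map_smul, hp₀]
    rw [← map_smul, smul_eq_mul, mul_one]
  let h : LinearMap.range d →ₗ[R] Y :=
    (LinearMap.ker d).liftQ z hz ∘ₗ d.quotKerEquivRange.symm.toLinearMap
  have hh (p : P₁) : h ⟨d p, p, rfl⟩ = z p := by
    have : d.quotKerEquivRange.symm ⟨d p, p, rfl⟩ = (LinearMap.ker d).mkQ p := by
      rw [LinearEquiv.symm_apply_eq]
      rfl
    simp [h, this]
  let σJ : J →ₗ[R] LinearMap.range d := (σ ∘ₗ J.subtype).codRestrict _ fun j ↦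
    (hdε _).1 ((hσ j).trans (by simpa using Ideal.Quotient.eq_zero_iff_mem.2 j.2))
  let τ : P₀ →ₗ[R] LinearMap.range d := (LinearMap.id - σ ∘ₗ π).codRestrict _ fun p ↦
    (hdε _).1 (by
      have := LinearMap.congr_fun hπ p
      simp only [LinearMap.comp_apply] at this
      simp [hσ, ← this])
  refine ⟨h ∘ₗ σJ, h ∘ₗ τ, LinearMap.ext fun p ↦ ?_⟩
  rw [← hh p]
  simp only [LinearMap.add_apply, LinearMap.comp_apply, ← map_add]
  congr 1
  ext
  exact (add_sub_cancel (σ (π (d p))) (d p)).symm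

end Cocycle

namespace CategoryTheory.ProjectiveResolution

variable {R : Type} [CommRing R] {J J' : Ideal R} {Y : ModuleCat.{0} R}
  (P : ProjectiveResolution (ModuleCat.of R (R ⧸ J)))
  (P' : ProjectiveResolution (ModuleCat.of R (R ⧸ J')))

/-- The augmentation of a resolution of `R ⧸ J`, as a linear map. -/
def augmentation : P.complex.X 0 →ₗ[R] R ⧸ J :=
  (P.π.f 0).hom

lemma exact_augmentation : Function.Exact (P.complex.d 1 0).hom P.augmentation := by
  have := P.exact₀
  exact (ShortComplex.ShortExact.moduleCat_exact_iff_function_exact _).1 this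

lemma augmentation_surjective : Function.Surjective P.augmentation :=
  (ModuleCat.epi_iff_surjective (P.π.f 0)).1 inferInstance

lemma ker_d_le_ker {z : P.complex.X 1 ⟶ Y} (hz : P.complex.d 2 1 ≫ z = 0) :
    LinearMap.ker (P.complex.d 1 0).hom ≤ LinearMap.ker z.hom := by
  intro p hp
  obtain ⟨q, rfl⟩ := (ShortComplex.moduleCat_exact_iff _).1 (P.exact_succ 0) p hp
  exact congr($(hz).hom q)

instance (n : ℕ) : Module.Projective R (P.complex.X n) :=
  (IsProjective.iff_projective _).2 (P.projective n)

lemma exists_cocycle_eq {π : P.complex.X 0 →ₗ[R] R} (hπ : J.mkQ ∘ₗ π = P.augmentation)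
    {z : P.complex.X 1 ⟶ Y} (hz : P.complex.d 2 1 ≫ z = 0) :
    ∃ (f : J →ₗ[R] Y) (b : P.complex.X 0 ⟶ Y),
      z = ModuleCat.ofHom (f ∘ₗ toIdeal P.exact_augmentation hπ) + P.complex.d 1 0 ≫ b := by
  obtain ⟨f, b, h⟩ := exists_eq_toIdeal_add P.exact_augmentation P.augmentation_surjective hπ
    z.hom (P.ker_d_le_ker hz)
  exact ⟨f, ModuleCat.ofHom b, ModuleCat.hom_ext h⟩

lemma d_comp_toIdeal {π : P.complex.X 0 →ₗ[R] R} (hπ : J.mkQ ∘ₗ π = P.augmentation)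
    (f : J →ₗ[R] Y) :
    P.complex.d 2 1 ≫ ModuleCat.ofHom (f ∘ₗ toIdeal P.exact_augmentation hπ) = 0 := by
  ext p
  have h : toIdeal P.exact_augmentation hπ (P.complex.d 2 1 p) = 0 := by
    ext
    have : P.complex.d 1 0 (P.complex.d 2 1 p) = 0 := congr($(P.complex.d_comp_d 2 1 0).hom p)
    simp [toIdeal, this]
  exact (congrArg f h).trans (map_zero f)

lemma finite_Ext_one (J : Ideal R) (Y : ModuleCat.{0} R) [Module.Finite R (J →ₗ[R] Y)] :
    Module.Finite R (((Ext R (ModuleCat R) 1).obj (op (ModuleCat.of R (R ⧸ J)))).obj Y) := by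
  let P := ProjectiveResolution.of (ModuleCat.of R (R ⧸ J))
  obtain ⟨π, hπ⟩ := exists_lift_mkQ P.augmentation
  let l : (J →ₗ[R] Y) →ₗ[R] (P.complex.X 1 ⟶ Y) :=
    ModuleCat.homLinearEquiv (S := R).symm.toLinearMap ∘ₗ
      LinearMap.lcomp R Y (toIdeal P.exact_augmentation hπ)
  have : Module.Finite R ((homShortComplex Y).obj P.complex).unop.homology :=
    ShortComplex.finite_homology (S := ((homShortComplex Y).obj P.complex).unop) l
      (fun f ↦ P.d_comp_toIdeal hπ f) fun z hz ↦ P.exists_cocycle_eq hπ hz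
  exact finite_Ext Y P

lemma epi_Ext_one_map (g : ModuleCat.of R (R ⧸ J') ⟶ ModuleCat.of R (R ⧸ J)) (hJ : J' ≤ J)
    (hg : g.hom = Submodule.mapQ J' J LinearMap.id hJ) (Y : ModuleCat.{0} R)
    (h : ∀ f' : J' →ₗ[R] Y, ∃ f : J →ₗ[R] Y, f ∘ₗ Submodule.inclusion hJ = f') :
    Epi (((Ext R (ModuleCat R) 1).map g.op).app Y) := by
  let P := ProjectiveResolution.of (ModuleCat.of R (R ⧸ J))
  let P' := ProjectiveResolution.of (ModuleCat.of R (R ⧸ J'))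
  obtain ⟨π, hπ⟩ := exists_lift_mkQ P.augmentation
  obtain ⟨π', hπ'⟩ := exists_lift_mkQ P'.augmentation
  let φ := ProjectiveResolution.lift g P' P
  have comm : φ.f 0 ≫ P.π.f 0 = P'.π.f 0 ≫ g := ProjectiveResolution.lift_commutes_zero g P' P
  have hδ (p : P'.complex.X 0) : π (φ.f 0 p) - π' p ∈ J := by
    have h1 : J.mkQ (π (φ.f 0 p)) = P.π.f 0 (φ.f 0 p) := LinearMap.congr_fun hπ _
    have h2 : J'.mkQ (π' p) = P'.π.f 0 p := LinearMap.congr_fun hπ' _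
    have h3 : P.π.f 0 (φ.f 0 p) = g.hom (P'.π.f 0 p) := congr($(comm).hom p)
    have h4 : J.mkQ (π (φ.f 0 p) - π' p) = 0 := by
      rw [map_sub, h1, h3, ← h2, hg, sub_eq_zero]
      rfl
    exact Ideal.Quotient.eq_zero_iff_mem.1 h4
  let δ : P'.complex.X 0 →ₗ[R] J := (π ∘ₗ (φ.f 0).hom - π').codRestrict J hδ
  have : Epi (ShortComplex.homologyMap (ShortComplex.unopMap ((homShortComplex Y).map φ))) := by
    refine ShortComplex.epi_homologyMap_of_forall_cycle _ fun (z : P'.complex.X 1 ⟶ Y) hz ↦ ?_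
    obtain ⟨f', b, rfl⟩ := P'.exists_cocycle_eq hπ' hz
    obtain ⟨f, rfl⟩ := h f'
    refine ⟨ModuleCat.ofHom (f ∘ₗ toIdeal P.exact_augmentation hπ), P.d_comp_toIdeal hπ f,
      b - ModuleCat.ofHom (f ∘ₗ δ), ?_⟩
    suffices ModuleCat.ofHom ((f ∘ₗ Submodule.inclusion hJ) ∘ₗ toIdeal P'.exact_augmentation hπ') +
        P'.complex.d 1 0 ≫ b =
        φ.f 1 ≫ ModuleCat.ofHom (f ∘ₗ toIdeal P.exact_augmentation hπ) +
        P'.complex.d 1 0 ≫ (b - ModuleCat.ofHom (f ∘ₗ δ)) from this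
    have key : Submodule.inclusion hJ ∘ₗ toIdeal P'.exact_augmentation hπ' =
        toIdeal P.exact_augmentation hπ ∘ₗ (φ.f 1).hom - δ ∘ₗ (P'.complex.d 1 0).hom := by
      ext p
      have : P.complex.d 1 0 (φ.f 1 p) = φ.f 0 (P'.complex.d 1 0 p) := congr($(φ.comm 1 0).hom p)
      simp [toIdeal, δ, this]
    rw [LinearMap.comp_assoc, key, LinearMap.comp_sub, Preadditive.comp_sub]
    ext p
    simp
    abel
  exact epi_Ext_map g Y P P' φ comm

end CategoryTheory.ProjectiveResolution

lemma localCohomology_one_finite {R : Type} [CommRing R] (I : Ideal R) (Y : ModuleCat.{0} R)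
    (n₀ : ℕ) [Module.Finite R (↥(I ^ n₀) →ₗ[R] Y)]
    (h : ∀ (n : ℕ) (hn : n₀ ≤ n) (f' : ↥(I ^ n) →ₗ[R] Y),
      ∃ f : ↥(I ^ n₀) →ₗ[R] Y, f ∘ₗ Submodule.inclusion (Ideal.pow_le_pow_right hn) = f') :
    Module.Finite R ((localCohomology I 1).obj Y) := by
  let D := localCohomology.diagram (localCohomology.idealPowersDiagram I) 1
  let E := D ⋙ (evaluation _ _).obj Y
  let e : (localCohomology I 1).obj Y ≅ Limits.colimit E :=
    Limits.colimitObjIsoColimitCompEvaluation D Y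
  suffices Module.Finite R ↑(Limits.colimit E) from Module.Finite.equiv e.symm.toLinearEquiv
  let j₀ : ℕᵒᵖᵒᵖ := op (op n₀)
  have : Module.Finite R (E.obj j₀) := ProjectiveResolution.finite_Ext_one (I ^ n₀) Y
  refine Module.Finite.of_surjective (Limits.colimit.ι E j₀).hom fun t ↦ ?_
  obtain ⟨j, y, rfl⟩ := Limits.Concrete.isColimit_exists_rep E (Limits.colimit.isColimit E) t
  let k : ℕᵒᵖᵒᵖ := op (op (max n₀ j.unop.unop))
  let a : j₀ ⟶ k := (homOfLE (le_max_left _ _)).op.op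
  let b : j ⟶ k := (homOfLE (le_max_right _ _)).op.op
  have ha : Epi (E.map a) :=
    ProjectiveResolution.epi_Ext_one_map _ (Ideal.pow_le_pow_right (le_max_left _ _)) rfl Y
      (h _ (le_max_left _ _))
  obtain ⟨w, hw⟩ := (ModuleCat.epi_iff_surjective _).1 ha (E.map b y)
  refine ⟨w, ?_⟩
  have h1 : Limits.colimit.ι E k (E.map a w) = Limits.colimit.ι E j₀ w :=
    congr($(Limits.colimit.w E a) w)
  have h2 : Limits.colimit.ι E k (E.map b y) = Limits.colimit.ι E j y :=
    congr($(Limits.colimit.w E b) y)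
  exact h1.symm.trans ((congrArg _ hw).trans h2)

section PowTorsion

variable {R : Type*} [CommRing R] {M : Type*} [AddCommGroup M] [Module R M]

/-- The submodule of elements annihilated by a power of the ideal `I`. -/
def powTorsion (I : Ideal R) (M : Type*) [AddCommGroup M] [Module R M] : Submodule R M where
  carrier := {q | ∃ n : ℕ, ∀ a ∈ I ^ n, a • q = 0}
  zero_mem' := ⟨0, fun _ _ ↦ smul_zero _⟩
  add_mem' := by
    rintro q q' ⟨n, hn⟩ ⟨n', hn'⟩
    refine ⟨max n n', fun a ha ↦ ?_⟩
    rw [smul_add, hn a (Ideal.pow_le_pow_right (le_max_left _ _) ha),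
      hn' a (Ideal.pow_le_pow_right (le_max_right _ _) ha), add_zero]
  smul_mem' := by
    rintro r q ⟨n, hn⟩
    exact ⟨n, fun a ha ↦ by rw [smul_comm, hn a ha, smul_zero]⟩

lemma exists_pow_smul_eq_zero_of_fg {I : Ideal R} {N : Submodule R M} (hN : N.FG)
    (h : N ≤ powTorsion I M) : ∃ n : ℕ, ∀ a ∈ I ^ n, ∀ q ∈ N, a • q = 0 := by
  induction N, hN using Submodule.fg_induction with
  | singleton q =>
    obtain ⟨n, hn⟩ := h (Submodule.mem_span_singleton_self q)
    refine ⟨n, fun a ha q' hq' ↦ ?_⟩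
    obtain ⟨r, rfl⟩ := Submodule.mem_span_singleton.1 hq'
    rw [smul_comm, hn a ha, smul_zero]
  | sup N₁ N₂ _ _ h₁ h₂ =>
    obtain ⟨n₁, hn₁⟩ := h₁ (le_sup_left.trans h)
    obtain ⟨n₂, hn₂⟩ := h₂ (le_sup_right.trans h)
    refine ⟨max n₁ n₂, fun a ha q hq ↦ ?_⟩
    obtain ⟨q₁, hq₁, q₂, hq₂, rfl⟩ := Submodule.mem_sup.1 hq
    rw [smul_add, hn₁ a (Ideal.pow_le_pow_right (le_max_left _ _) ha) q₁ hq₁,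
      hn₂ a (Ideal.pow_le_pow_right (le_max_right _ _) ha) q₂ hq₂, add_zero]

lemma isArtinian_of_maximalIdeal_pow_smul [IsNoetherianRing R] [IsLocalRing R]
    [Module.Finite R M] (n : ℕ) (h : ∀ a ∈ IsLocalRing.maximalIdeal R ^ n, ∀ q : M, a • q = 0) :
    IsArtinian R M := by
  let I := IsLocalRing.maximalIdeal R ^ (n + 1)
  have hI : I ≤ IsLocalRing.maximalIdeal R := Ideal.pow_le_self n.succ_ne_zero
  have htors : Module.IsTorsionBySet R M (I : Set R) := fun q a ↦
    h _ (Ideal.pow_le_pow_right n.le_succ a.2) q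
  have : Nontrivial (R ⧸ I) := Ideal.Quotient.nontrivial_iff.2
    (ne_top_of_le_ne_top (IsLocalRing.maximalIdeal.isMaximal R).ne_top hI)
  have : IsLocalRing (R ⧸ I) :=
    IsLocalRing.of_surjective' (Ideal.Quotient.mk I) Ideal.Quotient.mk_surjective
  have : IsArtinianRing (R ⧸ I) := by
    rw [isArtinianRing_iff_isNilpotent_maximalIdeal]
    refine ⟨n + 1, ?_⟩
    rw [← IsLocalRing.map_maximalIdeal_of_surjective (Ideal.Quotient.mk I)
      Ideal.Quotient.mk_surjective, ← Ideal.map_pow]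
    exact Ideal.map_quotient_self I
  let _ : Module (R ⧸ I) M := htors.module
  have : IsScalarTower R (R ⧸ I) M := htors.isScalarTower
  have : Module.Finite (R ⧸ I) M := Module.Finite.of_restrictScalars_finite R _ _
  have : IsArtinian (R ⧸ I) M := inferInstance
  exact isArtinian_of_surjective_algebraMap (R := R ⧸ I) Ideal.Quotient.mk_surjective

lemma exists_pow_smul_eq_pow_succ_smul {x : R} [IsArtinian R (Submodule.torsionBy R M x)]
    (h : ∀ q : M, ∃ n : ℕ, x ^ n • q = 0) :
    ∃ N : ℕ, ∀ q : M, ∃ q' : M, x ^ N • q = x ^ (N + 1) • q' := by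
  let D (n : ℕ) : Submodule R (Submodule.torsionBy R M x) :=
    (LinearMap.range (LinearMap.lsmul R M (x ^ n))).comap (Submodule.subtype _)
  have hD : Antitone D := antitone_nat_of_succ_le fun n ↦ by
    rintro q ⟨p, hp⟩
    exact ⟨x • p, hp ▸ by simp [smul_smul, pow_succ, mul_comm]⟩
  obtain ⟨N, hN⟩ := IsArtinian.monotone_stabilizes ⟨fun n ↦ OrderDual.toDual (D n), hD⟩
  have hDN (n : ℕ) (hn : N ≤ n) : D N = D n := hN n hn
  refine ⟨N, fun q ↦ ?_⟩
  obtain ⟨k, hk⟩ := h (x ^ N • q)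
  induction k generalizing q with
  | zero => exact ⟨0, by simpa using hk⟩
  | succ k ih =>
    have hmem : (⟨x ^ k • x ^ N • q, by
        rw [Submodule.mem_torsionBy_iff, smul_smul, ← pow_succ', hk]⟩ :
        Submodule.torsionBy R M x) ∈ D (N + k) := ⟨q, by simp [smul_smul, pow_add, mul_comm]⟩
    rw [← hDN _ (N.le_add_right k), hDN (N + k + 1) (by omega)] at hmem
    obtain ⟨q', hq'⟩ := hmem
    have hq' : x ^ (N + k + 1) • q' = x ^ k • x ^ N • q := hq'
    obtain ⟨p, hp⟩ := ih (q - x • q') (by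
      rw [smul_sub, smul_sub, ← hq', smul_smul, smul_smul, sub_eq_zero]
      ring_nf)
    refine ⟨p + q', ?_⟩
    rw [smul_add, ← hp, smul_sub, smul_smul, ← pow_succ, sub_add_cancel]

/-- If `x`-torsion is Artinian and no power of `x` annihilates an `x`-power-torsion module,
then its Tate module is nonzero. -/
lemma exists_pow_smul_eq_zero_or_exists_seq {x : R} [IsArtinian R (Submodule.torsionBy R M x)]
    (h : ∀ q : M, ∃ n : ℕ, x ^ n • q = 0) :
    (∃ N : ℕ, ∀ q : M, x ^ N • q = 0) ∨
      ∃ u : ℕ → M, u 0 = 0 ∧ u 1 ≠ 0 ∧ ∀ n, x • u (n + 1) = u n := by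
  obtain ⟨N, hN⟩ := exists_pow_smul_eq_pow_succ_smul h
  refine or_iff_not_imp_left.2 fun hne ↦ ?_
  push Not at hne
  obtain ⟨q, hq⟩ := hne N
  choose g hg using hN
  classical
  let k := Nat.find (h (x ^ N • q))
  have hk : x ^ k • x ^ N • q = 0 := Nat.find_spec (h (x ^ N • q))
  have hk0 : k ≠ 0 := fun h0 ↦ hq (by simpa [h0] using hk)
  have hk1 : x ^ (k - 1) • x ^ N • q ≠ 0 := Nat.find_min (h (x ^ N • q)) (by omega)
  let v (n : ℕ) : M := x ^ N • g^[n] (x ^ (k - 1) • q)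
  have hv (n : ℕ) : x • v (n + 1) = v n := by
    simp only [v, Function.iterate_succ_apply', smul_smul, ← pow_succ', ← hg]
  refine ⟨fun n ↦ n.casesOn 0 v, rfl, ?_, fun n ↦ ?_⟩
  · change x ^ N • x ^ (k - 1) • q ≠ 0
    rwa [smul_comm]
  · cases n with
    | zero =>
      change x • x ^ N • x ^ (k - 1) • q = 0
      rw [smul_comm (x ^ N), smul_smul, ← pow_succ', Nat.sub_add_cancel (by omega), hk]
    | succ n => exact hv n

end PowTorsion

section CompleteLocalDomain

open IsLocalRing

variable {R : Type*} [CommRing R] [IsLocalRing R]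

lemma maximalIdeal_ne_bot_of_one_lt_ringKrullDim (hdim : 1 < ringKrullDim R) :
    maximalIdeal R ≠ ⊥ := fun h ↦ by
  rw [← isField_iff_maximalIdeal_eq] at h
  rw [ringKrullDim_eq_zero_of_isField h] at hdim
  exact absurd hdim (by decide)

variable [IsNoetherianRing R]

lemma exists_limit_of_sub_mem_span_pow [IsAdicComplete (maximalIdeal R) R] {x : R}
    (hx : x ∈ maximalIdeal R) {a : ℕ → R} (ha : ∀ n, a (n + 1) - a n ∈ Ideal.span {x ^ n}) :
    ∃ l : R, ∀ n, l - a n ∈ Ideal.span {x ^ n} := by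
  have hmono {n k : ℕ} (h : n ≤ k) : a k - a n ∈ Ideal.span {x ^ n} := by
    induction k, h using Nat.le_induction with
    | base => simp
    | succ k hk ih =>
      rw [← sub_add_sub_cancel _ (a k)]
      exact add_mem (Ideal.span_singleton_le_span_singleton.2 (pow_dvd_pow x hk) (ha k)) ih
  have hle (n : ℕ) : Ideal.span {x ^ n} ≤ maximalIdeal R ^ n := by
    rw [Ideal.span_singleton_le_iff_mem]
    exact Ideal.pow_mem_pow hx n
  obtain ⟨l, hl⟩ := IsPrecomplete.prec (I := maximalIdeal R) inferInstance (f := a)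
    fun {m n} hmn ↦ by
      rw [SModEq.comm, SModEq.sub_mem]
      simpa using hle m (hmono hmn)
  refine ⟨l, fun n ↦ ?_⟩
  rw [← Ideal.Quotient.eq_zero_iff_mem]
  refine IsHausdorff.haus (I := maximalIdeal R) (M := R ⧸ Ideal.span {x ^ n}) inferInstance _
    fun k ↦ ?_
  have h1 : l - a (n + k) ∈ maximalIdeal R ^ k := by
    have := (SModEq.sub_mem.1 (hl (n + k)).symm)
    exact Ideal.pow_le_pow_right (Nat.le_add_left k n) (by simpa using this)
  have h2 : Ideal.Quotient.mk (Ideal.span {x ^ n}) (l - a n) =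
      (l - a (n + k)) • (1 : R ⧸ Ideal.span {x ^ n}) := by
    rw [Algebra.smul_def, mul_one, Ideal.Quotient.algebraMap_eq, Ideal.Quotient.eq,
      sub_sub_sub_cancel_left]
    exact hmono (Nat.le_add_right n k)
  rw [SModEq.zero, h2]
  exact Submodule.smul_mem_smul h1 trivial

lemma exists_mem_maximalIdeal_notMem_prime (hdim : 1 < ringKrullDim R) {x : R}
    (hx : x ∈ maximalIdeal R) :
    ∃ (p : Ideal R) (_ : p.IsPrime) (y : R), x ∈ p ∧ y ∈ maximalIdeal R ∧ y ∉ p := by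
  obtain ⟨p, hp, hpm⟩ := Ideal.exists_minimalPrimes_le
    ((Ideal.span_singleton_le_iff_mem _).2 hx)
  have := hp.1.1
  have hne : p ≠ maximalIdeal R := by
    rintro rfl
    have h1 := Ideal.height_le_one_of_isPrincipal_of_mem_minimalPrimes _ _ hp
    rw [← maximalIdeal_height_eq_ringKrullDim] at hdim
    exact absurd h1 (not_le.2 (by exact_mod_cast hdim))
  obtain ⟨y, hy, hyp⟩ := SetLike.exists_of_lt (lt_of_le_of_ne hpm hne)
  exact ⟨p, this, y, (Ideal.span_singleton_le_iff_mem _).1 hp.1.2, hy, hyp⟩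

lemma eq_zero_of_forall_pow_dvd_mul [IsDomain R] (hdim : 1 < ringKrullDim R) {x a : R}
    (hx : x ∈ maximalIdeal R)
    (h : ∀ n : ℕ, ∃ k : ℕ, ∀ b ∈ maximalIdeal R ^ k, x ^ n ∣ b * a) : a = 0 := by
  obtain ⟨p, _, y, hxp, hy, hyp⟩ := exists_mem_maximalIdeal_notMem_prime hdim hx
  let A := Localization.AtPrime p
  refine FaithfulSMul.algebraMap_injective R A ?_
  rw [map_zero, ← Ideal.mem_bot, ← Ideal.iInf_pow_eq_bot_of_isLocalRing (maximalIdeal A)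
    (maximalIdeal.isMaximal A).ne_top, Ideal.mem_iInf]
  intro n
  obtain ⟨k, hk⟩ := h n
  obtain ⟨r, hr⟩ := hk _ (Ideal.pow_mem_pow hy k)
  have hu : IsUnit (algebraMap R A (y ^ k)) :=
    IsLocalization.map_units A (⟨y ^ k, pow_mem (show y ∈ p.primeCompl from hyp) k⟩ : p.primeCompl)
  rw [← Ideal.unit_mul_mem_iff_mem _ hu, ← map_mul, hr, map_mul, map_pow]
  exact Ideal.mul_mem_right _ _ (Ideal.pow_mem_pow
    ((IsLocalization.AtPrime.to_map_mem_maximal_iff A p x).2 hxp) n)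

end CompleteLocalDomain

/-- The quotient `K / R` of the fraction field `K` of `R`. -/
abbrev FractionQuotient (R K : Type*) [CommRing R] [Field K] [Algebra R K] : Type _ :=
  K ⧸ LinearMap.range (Algebra.linearMap R K)

section FractionField

open IsLocalRing

variable {R : Type*} [CommRing R] {K : Type*} [Field K] [Algebra R K]

lemma mk_mem_powTorsion_iff {I : Ideal R} {s : K} :
    (Submodule.Quotient.mk s : FractionQuotient R K) ∈ powTorsion I (FractionQuotient R K) ↔
      ∃ n : ℕ, ∀ a ∈ I ^ n, ∃ r : R, algebraMap R K r = algebraMap R K a * s := by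
  refine exists_congr fun n ↦ forall₂_congr fun a _ ↦ ?_
  rw [← Submodule.Quotient.mk_smul, Submodule.Quotient.mk_eq_zero, Algebra.smul_def]
  rfl

variable [IsNoetherianRing R] [IsFractionRing R K]

lemma fg_of_le_torsionBy {x : R} (hx : x ≠ 0) {N : Submodule R (FractionQuotient R K)}
    (hN : N ≤ Submodule.torsionBy R (FractionQuotient R K) x) : N.FG := by
  let q : FractionQuotient R K := Submodule.Quotient.mk (algebraMap R K x)⁻¹
  have hle : N ≤ Submodule.span R {q} := fun t ht ↦ by
    obtain ⟨s, rfl⟩ := Submodule.Quotient.mk_surjective _ t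
    have hs := hN ht
    rw [Submodule.mem_torsionBy_iff, ← Submodule.Quotient.mk_smul,
      Submodule.Quotient.mk_eq_zero] at hs
    obtain ⟨r, hr⟩ := hs
    refine Submodule.mem_span_singleton.2 ⟨r, ?_⟩
    have hx' : algebraMap R K x ≠ 0 := by simpa using hx
    rw [← Submodule.Quotient.mk_smul]
    congr 1
    rw [Algebra.linearMap_apply, Algebra.smul_def] at hr
    rw [Algebra.smul_def, hr]
    field_simp
  have := isNoetherian_of_le hle
  exact (isNoetherian_submodule.1 this) N le_rfl

variable [IsLocalRing R] [IsDomain R]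

variable (R K) in
lemma fg_powTorsion_maximalIdeal [IsAdicComplete (maximalIdeal R) R]
    (hdim : 1 < ringKrullDim R) :
    (powTorsion (maximalIdeal R) (FractionQuotient R K)).FG := by
  have hm := maximalIdeal_ne_bot_of_one_lt_ringKrullDim hdim
  obtain ⟨x, hx, hx0⟩ := Submodule.exists_mem_ne_zero_of_ne_bot hm
  have hxK : algebraMap R K x ≠ 0 := by simpa using hx0
  have inj := IsFractionRing.injective R K
  set H := powTorsion (maximalIdeal R) (FractionQuotient R K)
  have hH (q : H) : ∃ n : ℕ, x ^ n • q = 0 := by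
    obtain ⟨n, hn⟩ := q.2
    exact ⟨n, Subtype.ext (hn _ (Ideal.pow_mem_pow hx n))⟩
  have hTle : (Submodule.torsionBy R H x).map H.subtype ≤ Submodule.torsionBy R (FractionQuotient R K) x := by
    rintro _ ⟨q, hq, rfl⟩
    exact congrArg Subtype.val hq
  have hTfg := fg_of_le_torsionBy hx0 hTle
  obtain ⟨n, hn⟩ := exists_pow_smul_eq_zero_of_fg (I := maximalIdeal R) hTfg
    (Submodule.map_subtype_le _ _)
  have : Module.Finite R (Submodule.torsionBy R H x) := Module.Finite.iff_fg.2
    (Submodule.fg_of_fg_map_injective _ H.injective_subtype hTfg)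
  have : IsArtinian R (Submodule.torsionBy R H x) :=
    isArtinian_of_maximalIdeal_pow_smul (M := Submodule.torsionBy R H x) n fun a ha q ↦
      Subtype.ext (Subtype.ext (hn a ha _ ⟨q, q.2, rfl⟩))
  rcases exists_pow_smul_eq_zero_or_exists_seq (M := H) hH with ⟨N, hN⟩ | ⟨u, hu0, hu1, hu⟩
  · exact fg_of_le_torsionBy (pow_ne_zero N hx0) fun q hq ↦
      congrArg Subtype.val (hN ⟨q, hq⟩)
  exfalso
  choose s hs using fun n ↦ Submodule.Quotient.mk_surjective _ (u n : FractionQuotient R K)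
  have hr (n : ℕ) : ∃ r : R, algebraMap R K r = algebraMap R K x * s (n + 1) - s n := by
    have : (Submodule.Quotient.mk (x • s (n + 1) - s n) : FractionQuotient R K) = 0 := by
      rw [Submodule.Quotient.mk_sub, Submodule.Quotient.mk_smul, hs, hs, ← hu n, sub_eq_zero]
      rfl
    obtain ⟨r, hr⟩ := (Submodule.Quotient.mk_eq_zero _).1 this
    exact ⟨r, by rw [← Algebra.smul_def, ← hr, Algebra.linearMap_apply]⟩
  choose r hr using hr
  have ha (n : ℕ) : ∃ a : R, algebraMap R K a = algebraMap R K x ^ n * s n := by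
    induction n with
    | zero =>
      have : (Submodule.Quotient.mk (s 0) : FractionQuotient R K) = 0 := by rw [hs, hu0]; rfl
      obtain ⟨a, ha⟩ := (Submodule.Quotient.mk_eq_zero _).1 this
      exact ⟨a, by simpa using ha⟩
    | succ n ih =>
      obtain ⟨a, ha⟩ := ih
      refine ⟨a + x ^ n * r n, ?_⟩
      rw [map_add, ha, map_mul, hr, map_pow]
      ring
  choose a ha using ha
  obtain ⟨l, hl⟩ := exists_limit_of_sub_mem_span_pow hx (a := a) fun n ↦ by
    rw [Ideal.mem_span_singleton]
    refine ⟨r n, inj ?_⟩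
    rw [map_sub, ha, ha, map_mul, hr, map_pow]
    ring
  simp only [Ideal.mem_span_singleton, dvd_def] at hl
  choose t ht using hl
  have htK (n : ℕ) : algebraMap R K l = algebraMap R K x ^ n * (s n + algebraMap R K (t n)) := by
    rw [mul_add, ← ha, ← map_pow, ← map_mul, ← ht, ← map_add, add_sub_cancel]
  have hl0 : l = 0 := by
    refine eq_zero_of_forall_pow_dvd_mul hdim hx fun n ↦ ?_
    obtain ⟨k, hk⟩ := mk_mem_powTorsion_iff.1 ((hs n).symm ▸ (u n).2)
    refine ⟨k, fun b hb ↦ ?_⟩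
    obtain ⟨c, hc⟩ := hk b hb
    refine ⟨c + b * t n, inj ?_⟩
    rw [map_mul, htK n, map_mul, map_add, hc, map_mul, map_pow]
    ring
  refine hu1 (Subtype.ext ?_)
  rw [← hs 1]
  refine (Submodule.Quotient.mk_eq_zero _).2 ⟨-t 1, ?_⟩
  have h1 := htK 1
  rw [hl0, map_zero, pow_one, eq_comm, mul_eq_zero, or_iff_right hxK] at h1
  rw [Algebra.linearMap_apply, map_neg, eq_neg_of_add_eq_zero_left h1]

end FractionField

/-- Homomorphisms into `R` from deep powers of the maximal ideal extend to a fixed power. -/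
lemma exists_forall_linearMap_extends {R : Type*} [CommRing R] [IsNoetherianRing R]
    [IsLocalRing R] [IsDomain R] [IsAdicComplete (IsLocalRing.maximalIdeal R) R]
    (hdim : 1 < ringKrullDim R) :
    ∃ n₀ : ℕ, ∀ (n : ℕ) (hn : n₀ ≤ n) (f' : ↥(IsLocalRing.maximalIdeal R ^ n) →ₗ[R] R),
      ∃ f : ↥(IsLocalRing.maximalIdeal R ^ n₀) →ₗ[R] R,
        f ∘ₗ Submodule.inclusion (Ideal.pow_le_pow_right hn) = f' := by
  let K := FractionRing R
  have inj := IsFractionRing.injective R K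
  have hm := maximalIdeal_ne_bot_of_one_lt_ringKrullDim hdim
  obtain ⟨n₀, hn₀⟩ := exists_pow_smul_eq_zero_of_fg (fg_powTorsion_maximalIdeal R K hdim) le_rfl
  refine ⟨n₀, fun n hn f' ↦ ?_⟩
  obtain ⟨a, ha, ha0⟩ := Submodule.exists_mem_ne_zero_of_ne_bot (pow_ne_zero n hm)
  have haK : algebraMap R K a ≠ 0 := by simpa using ha0
  let s : K := algebraMap R K (f' ⟨a, ha⟩) / algebraMap R K a
  have hs (b : R) (hb : b ∈ IsLocalRing.maximalIdeal R ^ n) :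
      algebraMap R K (f' ⟨b, hb⟩) = algebraMap R K b * s := by
    rw [← mul_div_assoc, eq_div_iff haK, ← map_mul, ← map_mul, mul_comm]
    congr 1
    rw [← smul_eq_mul, ← smul_eq_mul, ← map_smul, ← map_smul]
    congr 1
    ext
    exact mul_comm _ _
  have hsH := mk_mem_powTorsion_iff.2 ⟨n, fun b hb ↦ ⟨f' ⟨b, hb⟩, hs b hb⟩⟩
  let e := LinearEquiv.ofInjective (Algebra.linearMap R K) inj
  let m : ↥(IsLocalRing.maximalIdeal R ^ n₀) →ₗ[R] LinearMap.range (Algebra.linearMap R K) :=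
    (LinearMap.toSpanSingleton R K s ∘ₗ Submodule.subtype _).codRestrict _ fun b ↦
      (Submodule.Quotient.mk_eq_zero _).1 (hn₀ b b.2 _ hsH)
  refine ⟨e.symm.toLinearMap ∘ₗ m, LinearMap.ext fun b ↦ ?_⟩
  change e.symm (m _) = _
  rw [LinearEquiv.symm_apply_eq]
  ext
  exact (Algebra.smul_def _ _).trans (hs b b.2).symm

/-- If `(R, 𝔪)` is a Noetherian complete local domain of Krull dimension `2`, then
`H^1_𝔪(R)` is a finitely generated `R`-module. -/
theorem localCohomology_finite_of_complete (R : Type) [CommRing R] [IsDomain R]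
    [IsNoetherianRing R] [IsLocalRing R]
    [IsAdicComplete (IsLocalRing.maximalIdeal R) R] (hdim : ringKrullDim R = 2) :
    Module.Finite R
      ((localCohomology (IsLocalRing.maximalIdeal R) 1).obj (ModuleCat.of R R)) := by
  obtain ⟨n₀, h⟩ := exists_forall_linearMap_extends (R := R) (by rw [hdim]; decide)
  have : Module.Finite R (↥(IsLocalRing.maximalIdeal R ^ n₀) →ₗ[R] R) := by
    obtain ⟨k, g, hg⟩ := Module.Finite.exists_fin' R ↥(IsLocalRing.maximalIdeal R ^ n₀)
    exact Module.Finite.of_injective (LinearMap.lcomp R R g) fun f f' hf ↦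
      (LinearMap.cancel_right hg).1 hf
  exact localCohomology_one_finite _ (ModuleCat.of R R) n₀ h
end
end

section
/- Let $k$ be a field, $R = k[[x,y,z,w]]$ the formal power series ring in four variables, and $I = (x,z)$. Then the $R$-module $H^2_I(R)$ is $I$-cofinite, $\operatorname{Supp}_R(H^2_I(R)) = \operatorname{Supp}_R(R/I)$, and $\dim_R H^2_I(R) = 2$. -/
open CategoryTheory

noncomputable section

/-- An `R`-module `M` is `I`-cofinite if `Supp M ⊆ V(I)` and `Ext^i_R(R/I, M)` is a finitely
generated `R`-module for all `i ≥ 0`. -/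
def IsCofinite (R : Type) [CommRing R] (I : Ideal R) (M : Type) [AddCommGroup M]
    [Module R M] : Prop :=
  Module.support R M ⊆ PrimeSpectrum.zeroLocus (I : Set R) ∧
    ∀ i : ℕ, Module.Finite R
      (((Ext R (ModuleCat.{0} R) i).obj (Opposite.op (ModuleCat.of R (R ⧸ I)))).obj
        (ModuleCat.of R M))

universe u

section Koszul

variable {R : Type u} [CommRing R]

/-- The terms of the Koszul complex on two elements. -/
def koszulX (R : Type u) [CommRing R] : ℕ → ModuleCat.{u} R
  | 0 => ModuleCat.of R R
  | 1 => ModuleCat.of R (R × R)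
  | 2 => ModuleCat.of R R
  | _ + 3 => ModuleCat.of R PUnit

/-- The differentials of the Koszul complex on `a` and `b`. -/
def koszulD (a b : R) : ∀ n, koszulX R (n + 1) ⟶ koszulX R n
  | 0 => ModuleCat.ofHom (a • LinearMap.fst R R R + b • LinearMap.snd R R R)
  | 1 => ModuleCat.ofHom ((b • LinearMap.id).prod (-(a • LinearMap.id)))
  | _ + 2 => 0

lemma koszulD_comp (a b : R) : ∀ n, koszulD a b (n + 1) ≫ koszulD a b n = 0
  | 0 => by
    refine ModuleCat.hom_ext (LinearMap.ext fun (x : R) => ?_)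
    change a * (b * x) + b * (-(a * x)) = 0
    ring
  | _ + 1 => Limits.zero_comp

/-- The Koszul complex on `a` and `b`. -/
def koszul (a b : R) : ChainComplex (ModuleCat.{u} R) ℕ :=
  ChainComplex.of (koszulX R) (koszulD a b) (koszulD_comp a b)

lemma koszul_d (a b : R) (n : ℕ) : (koszul a b).d (n + 1) n = koszulD a b n :=
  ChainComplex.of_d _ _ _

instance projective_koszulX : ∀ n, Projective (koszulX R n)
  | 0 => inferInstanceAs (Projective (ModuleCat.of R R))
  | 1 => inferInstanceAs (Projective (ModuleCat.of R (R × R)))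
  | 2 => inferInstanceAs (Projective (ModuleCat.of R R))
  | _ + 3 => inferInstanceAs (Projective (ModuleCat.of R PUnit))

/-- The pair `a`, `b` has acyclic Koszul complex in positive degrees. -/
structure KoszulExact (a b : R) : Prop where
  exact_one : ∀ u v : R, a * u + b * v = 0 → ∃ r, b * r = u ∧ -(a * r) = v
  injective : ∀ r : R, b * r = 0 → -(a * r) = 0 → r = 0

lemma koszul_exactAt_succ {a b : R} (h : KoszulExact a b) (n : ℕ) :
    (koszul a b).ExactAt (n + 1) := by
  rw [HomologicalComplex.exactAt_iff' _ (n + 1 + 1) (n + 1) n (by simp) (by simp),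
    ShortComplex.moduleCat_exact_iff]
  dsimp only [HomologicalComplex.sc', HomologicalComplex.shortComplexFunctor']
  rw [koszul_d, koszul_d]
  match n with
  | 0 =>
    rintro ⟨u, v⟩ huv
    obtain ⟨r, hu, hv⟩ := h.exact_one u v huv
    exact ⟨r, Prod.ext hu hv⟩
  | 1 =>
    intro (r : R) hr
    have hr : ((b * r, -(a * r)) : R × R) = 0 := hr
    rw [Prod.ext_iff] at hr
    exact ⟨0, (map_zero _).trans (h.injective r hr.1 hr.2).symm⟩
  | _ + 2 =>
    intro _ _
    exact ⟨0, rfl⟩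

/-- The Koszul complex on `a` and `b` resolves `R ⧸ J` for `J = (a, b)`. -/
def koszulResolution {a b : R} (h : KoszulExact a b) (J : Ideal R) (hJ : J = Ideal.span {a, b}) :
    ProjectiveResolution (ModuleCat.of R (R ⧸ J)) where
  complex := koszul a b
  projective := projective_koszulX
  π := (ChainComplex.toSingle₀Equiv _ _).symm ⟨ModuleCat.ofHom J.mkQ, by
    rw [koszul_d]
    refine ModuleCat.hom_ext (LinearMap.ext fun (x : R × R) => ?_)
    refine (Submodule.Quotient.mk_eq_zero J).2 ?_
    change a * x.1 + b * x.2 ∈ J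
    rw [hJ, Ideal.mem_span_pair]
    exact ⟨x.1, x.2, by ring⟩⟩
  quasiIso := ⟨fun n => by
    cases n
    · rw [ChainComplex.quasiIsoAt₀_iff, ShortComplex.quasiIso_iff_of_zeros']
      · refine (ShortComplex.exact_and_epi_g_iff_of_iso
          (S₂ := ShortComplex.mk (koszulD a b 0) (ModuleCat.ofHom J.mkQ) ?_) ?_).2
          ⟨?_, ?_⟩
        · refine ModuleCat.hom_ext (LinearMap.ext fun (x : R × R) => ?_)
          refine (Submodule.Quotient.mk_eq_zero J).2 ?_
          change a * x.1 + b * x.2 ∈ J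
          rw [hJ, Ideal.mem_span_pair]
          exact ⟨x.1, x.2, by ring⟩
        · exact ShortComplex.isoMk (Iso.refl _) (Iso.refl _) (Iso.refl _)
            (by dsimp; simp [koszul_d]; rfl) (by simp; rfl)
        · rw [ShortComplex.moduleCat_exact_iff]
          intro (x : R) hx
          have hx := (Submodule.Quotient.mk_eq_zero J).1 hx
          rw [hJ, Ideal.mem_span_pair] at hx
          obtain ⟨u, v, rfl⟩ := hx
          refine ⟨((u, v) : R × R), ?_⟩
          change a * u + b * v = _
          ring
        · exact (ModuleCat.epi_iff_surjective _).2 J.mkQ_surjective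
      all_goals rfl
    · rw [quasiIsoAt_iff_exactAt']
      · exact koszul_exactAt_succ h _
      · apply ChainComplex.exactAt_succ_single_obj⟩

lemma HomologicalComplex.exists_ker_surjective_homology {ι : Type*} {c : ComplexShape ι}
    (K : HomologicalComplex (ModuleCat.{u} R) c) (i j k : ι) (hi : c.prev j = i)
    (hk : c.next j = k) :
    ∃ π : LinearMap.ker (K.d j k).hom →ₗ[R] K.homology j, Function.Surjective π := by
  let S := K.sc' i j k
  let π : LinearMap.ker S.g.hom →ₗ[R] K.homology j :=
    ((K.homologyIsoSc' i j k hi hk).toLinearEquiv.symm.toLinearMap ∘ₗ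
      S.moduleCatHomologyIso.toLinearEquiv.symm.toLinearMap) ∘ₗ
      (LinearMap.range S.moduleCatToCycles).mkQ
  have hπ : Function.Surjective π :=
    ((K.homologyIsoSc' i j k hi hk).toLinearEquiv.symm.surjective.comp
      S.moduleCatHomologyIso.toLinearEquiv.symm.surjective).comp (Submodule.mkQ_surjective _)
  exact ⟨π, hπ⟩

/-- Exactness in positive degrees of the complex of maps from the Koszul complex to `M`. -/
lemma exists_koszulD_comp_eq {a b : R} (M : ModuleCat.{u} R)
    (ha : ∀ m : M, ∃ m', a • m' = m)
    (hb : ∀ m : M, a • m = 0 → ∃ m', a • m' = 0 ∧ b • m' = m) :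
    ∀ (n : ℕ) (φ : koszulX R (n + 1) ⟶ M), koszulD a b (n + 1) ≫ φ = 0 →
      ∃ ψ : koszulX R n ⟶ M, koszulD a b n ≫ ψ = φ
  | 0, φ, hφ => by
    have key (r : R) : φ.hom ((b * r, -(a * r)) : R × R) = 0 :=
      LinearMap.congr_fun (congrArg ModuleCat.Hom.hom hφ) r
    let φ' : R × R →ₗ[R] M := φ.hom
    obtain ⟨t, ht⟩ := ha (φ' (1, 0))
    have hcomp : b • φ' (1, 0) = a • φ' (0, 1) := by
      rw [← sub_eq_zero, ← map_smul, ← map_smul, ← map_sub]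
      simpa using! key 1
    obtain ⟨s, hs, hs'⟩ := hb (φ' (0, 1) - b • t) (by
      rw [smul_sub, smul_comm, ht, hcomp, sub_self])
    refine ⟨ModuleCat.ofHom (LinearMap.toSpanSingleton R M (t + s)), ?_⟩
    refine ModuleCat.hom_ext (LinearMap.ext fun (x : R × R) => ?_)
    change (a * x.1 + b * x.2) • (t + s) = φ' x
    have hx : x = x.1 • (1, 0) + x.2 • (0, 1) := by ext <;> simp
    conv_rhs => rw [hx, map_add, map_smul, map_smul, ← ht, ← sub_add_cancel (φ' (0, 1)) (b • t),
      ← hs']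
    have hs1 : (a * x.1) • s = 0 := by rw [mul_comm, mul_smul, hs, smul_zero]
    rw [add_smul, smul_add, hs1]
    module
  | 1, φ, hφ => by
    let φ' : R →ₗ[R] M := φ.hom
    obtain ⟨t, ht⟩ := ha (φ' 1)
    refine ⟨ModuleCat.ofHom (-(LinearMap.toSpanSingleton R M t) ∘ₗ LinearMap.snd R R R), ?_⟩
    refine ModuleCat.hom_ext (LinearMap.ext fun (x : R) => ?_)
    change -((-(a * x)) • t) = φ' x
    have hx : x = x • 1 := by simp
    conv_rhs => rw [hx, map_smul, ← ht]
    module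
  | _ + 2, φ, _ => by
    refine ⟨0, ModuleCat.hom_ext (LinearMap.ext fun x => ?_)⟩
    exact (φ.hom.map_zero).symm

/-- Over a Noetherian ring, the Ext modules of `R ⧸ (a, b)` with values in `M` are finite if
`a` acts surjectively on `M`, `b` acts surjectively on the `a`-torsion, and the elements
killed by both `a` and `b` lie in a finite submodule. -/
lemma finite_ext_of_koszulExact [IsNoetherianRing R] {a b : R} (h : KoszulExact a b)
    {J : Ideal R} (hJ : J = Ideal.span {a, b}) (M : ModuleCat.{u} R)
    (ha : ∀ m : M, ∃ m', a • m' = m)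
    (hb : ∀ m : M, a • m = 0 → ∃ m', a • m' = 0 ∧ b • m' = m)
    (N : Submodule R M) [Module.Finite R N] (hN : ∀ m : M, a • m = 0 → b • m = 0 → m ∈ N)
    (i : ℕ) :
    Module.Finite R
      (((Ext R (ModuleCat.{u} R) i).obj (Opposite.op (ModuleCat.of R (R ⧸ J)))).obj M) := by
  let P := koszulResolution h J hJ
  let K := P.complex.linearYonedaObj R M
  suffices Module.Finite R (K.homology i) from
    Module.Finite.equiv (P.isoExt i M).toLinearEquiv.symm
  have hd (n : ℕ) (φ : koszulX R n ⟶ M) : K.d n (n + 1) φ = koszulD a b n ≫ φ := by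
    refine (?_ : _ = (koszul a b).d (n + 1) n ≫ φ).trans (by rw [koszul_d]; rfl)
    rfl
  cases i with
  | zero =>
    obtain ⟨π, hπ⟩ := K.exists_ker_surjective_homology 0 0 1 (by simp) (by simp)
    have hfin : Module.Finite R (LinearMap.ker (K.d 0 1).hom) := by
      let ev : (koszulX R 0 ⟶ M) →ₗ[R] M :=
        { toFun := fun φ => φ (1 : R)
          map_add' := fun _ _ => rfl
          map_smul' := fun _ _ => rfl }
      have hev (φ : LinearMap.ker (K.d 0 1).hom) : ev φ.1 ∈ N := by
        obtain ⟨φ, hφ⟩ := φ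
        have hφ : koszulD a b 0 ≫ φ = 0 := (hd 0 φ).symm.trans hφ
        have key (x : R × R) : φ.hom (a * x.1 + b * x.2 : R) = 0 :=
          LinearMap.congr_fun (congrArg ModuleCat.Hom.hom hφ) x
        apply hN
        · refine (φ.hom.map_smul a (1 : R)).symm.trans (.trans (congrArg φ.hom ?_) (key (1, 0)))
          change a * (1 : R) = a * 1 + b * 0
          ring
        · refine (φ.hom.map_smul b (1 : R)).symm.trans (.trans (congrArg φ.hom ?_) (key (0, 1)))
          change b * (1 : R) = a * 0 + b * 1
          ring
      refine Module.Finite.of_injective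
        ((ev ∘ₗ (LinearMap.ker (K.d 0 1).hom).subtype).codRestrict N hev) ?_
      intro φ ψ hφψ
      refine Subtype.ext (ModuleCat.hom_ext (LinearMap.ext_ring ?_))
      exact congrArg Subtype.val hφψ
    exact Module.Finite.of_surjective π hπ
  | succ n =>
    have hex : K.ExactAt (n + 1) := by
      rw [HomologicalComplex.exactAt_iff' _ n (n + 1) (n + 1 + 1) (by simp) (by simp),
        ShortComplex.moduleCat_exact_iff]
      intro (φ : koszulX R (n + 1) ⟶ M) hφ
      have hφ : koszulD a b (n + 1) ≫ φ = 0 := (hd (n + 1) φ).symm.trans hφ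
      suffices ∃ ψ : koszulX R n ⟶ M, koszulD a b n ≫ ψ = φ by
        obtain ⟨ψ, hψ⟩ := this
        exact ⟨ψ, (hd n ψ).trans hψ⟩
      exact exists_koszulD_comp_eq M ha hb n φ hφ
    have := ModuleCat.subsingleton_of_isZero (HomologicalComplex.ExactAt.isZero_homology hex)
    infer_instance

/-- The map of cochain complexes of morphisms into `Y` induced by a chain map. -/
def ChainComplex.linearYonedaMap {X X' : ChainComplex (ModuleCat.{u} R) ℕ} (φ : X ⟶ X')
    (Y : ModuleCat.{u} R) : X'.linearYonedaObj R Y ⟶ X.linearYonedaObj R Y :=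
  (HomologicalComplex.unopFunctor _ _).map
    ((((linearYoneda R (ModuleCat.{u} R)).obj Y).rightOp.mapHomologicalComplex _).map φ).op

lemma HomologicalComplex.unop_homologyMap_comp_homologyOp_inv_unop
    {C : Type*} [Category* C] [Limits.HasZeroMorphisms C] [CategoryWithHomology C] {ι : Type*}
    {c : ComplexShape ι}
    {K L : HomologicalComplex C c} (φ : K ⟶ L) (i : ι) :
    (HomologicalComplex.homologyMap ((HomologicalComplex.opFunctor C c).map φ.op) i).unop ≫
        (L.homologyOp i).inv.unop =
      (K.homologyOp i).inv.unop ≫ HomologicalComplex.homologyMap φ i := by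
  have h := HomologicalComplex.homologyOp_hom_naturality φ (i := i)
  apply Quiver.Hom.op_inj
  refine (Iso.inv_comp_eq (L.homologyOp i)).2 ?_
  refine Eq.trans ?_ (Category.assoc _ _ _)
  exact (Iso.eq_comp_inv (K.homologyOp i)).2 h

lemma CategoryTheory.ProjectiveResolution.isoExt_hom_naturality {X X' : ModuleCat.{u} R}
    (f : X ⟶ X') (P : ProjectiveResolution X) (Q : ProjectiveResolution X')
    (φ : P.complex ⟶ Q.complex) (comm : φ.f 0 ≫ Q.π.f 0 = P.π.f 0 ≫ f) (n : ℕ)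
    (Y : ModuleCat.{u} R) :
    ((Ext R (ModuleCat.{u} R) n).map f.op).app Y ≫ (P.isoExt n Y).hom =
      (Q.isoExt n Y).hom ≫
        HomologicalComplex.homologyMap (ChainComplex.linearYonedaMap φ Y) n := by
  have h := congrArg Quiver.Hom.unop (P.isoLeftDerivedObj_inv_naturality f Q φ comm
    ((linearYoneda R (ModuleCat.{u} R)).obj Y).rightOp n)
  have h'' := HomologicalComplex.unop_homologyMap_comp_homologyOp_inv_unop
    (ChainComplex.linearYonedaMap φ Y) n
  rw [unop_comp, unop_comp] at h
  refine (Category.assoc _ _ _).symm.trans ?_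
  refine (congrArg (fun t ↦ t ≫ _) h).trans ?_
  refine (Category.assoc _ _ _).trans ?_
  refine Eq.trans ?_ (Category.assoc _ _ _).symm
  refine congrArg (fun t ↦ _ ≫ t) ?_
  exact h''

namespace HomologicalComplex

section

variable {C : Type*} [Category* C] [Abelian C] {ι : Type*} {c : ComplexShape ι}

/-- The projection onto homology in a degree where the outgoing differential vanishes. -/
def classOfNextZero (K : HomologicalComplex C c) (j : ι) (hj : K.d j (c.next j) = 0) :
    K.X j ⟶ K.homology j :=
  K.liftCycles (𝟙 _) (c.next j) rfl (by rw [Category.id_comp, hj]) ≫ K.homologyπ j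

lemma classOfNextZero_naturality {K L : HomologicalComplex C c} (φ : K ⟶ L) (j : ι)
    (hK : K.d j (c.next j) = 0) (hL : L.d j (c.next j) = 0) :
    K.classOfNextZero j hK ≫ homologyMap φ j = φ.f j ≫ L.classOfNextZero j hL := by
  rw [classOfNextZero, classOfNextZero, Category.assoc, homologyπ_naturality,
    ← Category.assoc, ← Category.assoc]
  congr 1
  rw [← cancel_mono (L.iCycles j)]
  simp

lemma iCycles_liftCycles_id (K : HomologicalComplex C c) (j : ι) (hj : K.d j (c.next j) = 0) :
    K.iCycles j ≫ K.liftCycles (𝟙 _) (c.next j) rfl (by rw [Category.id_comp, hj]) = 𝟙 _ := by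
  rw [← cancel_mono (K.iCycles j)]
  simp

instance epi_classOfNextZero (K : HomologicalComplex C c) (j : ι)
    (hj : K.d j (c.next j) = 0) : Epi (K.classOfNextZero j hj) := by
  have : Epi (K.iCycles j ≫ K.classOfNextZero j hj) := by
    rw [classOfNextZero, ← Category.assoc, K.iCycles_liftCycles_id j hj, Category.id_comp]
    infer_instance
  exact epi_of_epi (K.iCycles j) _

end

lemma classOfNextZero_eq_zero_iff {ι : Type*} {c : ComplexShape ι}
    (K : HomologicalComplex (ModuleCat.{u} R) c) (i j : ι)
    (hi : c.prev j = i) (hj : K.d j (c.next j) = 0) (x : K.X j) :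
    K.classOfNextZero j hj x = 0 ↔ ∃ y, K.d i j y = x := by
  have hex : (ShortComplex.mk _ _ (K.toCycles_comp_homologyπ i j)).Exact :=
    ShortComplex.exact_of_g_is_cokernel _ (K.homologyIsCokernel i j hi)
  rw [ShortComplex.moduleCat_exact_iff] at hex
  let l := K.liftCycles (𝟙 (K.X j)) (c.next j) rfl (by rw [Category.id_comp, hj])
  have hl : l ≫ K.iCycles j = 𝟙 _ := K.liftCycles_i _ _ _ _
  constructor
  · intro h
    obtain ⟨y, hy⟩ := hex (l x) h
    refine ⟨y, ?_⟩
    have := congrArg (K.iCycles j) hy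
    rwa [← ConcreteCategory.comp_apply, ← ConcreteCategory.comp_apply, hl, toCycles_i] at this
  · rintro ⟨y, rfl⟩
    rw [← ConcreteCategory.comp_apply, classOfNextZero]
    have : K.d i j = K.toCycles i j ≫ K.iCycles j := (K.toCycles_i i j).symm
    rw [this, Category.assoc, ← Category.assoc (K.iCycles j)]
    rw [K.iCycles_liftCycles_id j hj, Category.id_comp, toCycles_comp_homologyπ]
    rfl

end HomologicalComplex

/-- A ring element as a top degree cochain on the Koszul complex. -/
def koszulTopCochain (R : Type u) [CommRing R] : R →ₗ[R] (koszulX R 2 ⟶ ModuleCat.of R R) where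
  toFun r := ModuleCat.ofHom (LinearMap.toSpanSingleton R R r)
  map_add' r s := ModuleCat.hom_ext (LinearMap.ext fun (x : R) => smul_add x r s)
  map_smul' r s := ModuleCat.hom_ext (LinearMap.ext fun (x : R) => smul_comm x r s)

lemma koszulTopCochain_surjective : Function.Surjective (koszulTopCochain R) := fun φ =>
  ⟨φ.hom (1 : R), ModuleCat.hom_ext (LinearMap.ext_ring (one_smul R (φ.hom (1 : R))))⟩

lemma koszul_linearYonedaObj_d_two (a b : R) :
    ((koszul a b).linearYonedaObj R (ModuleCat.of R R)).d 2 ((ComplexShape.up ℕ).next 2) = 0 := by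
  rw [CochainComplex.next]
  refine ModuleCat.hom_ext (LinearMap.ext fun (φ : koszulX R 2 ⟶ ModuleCat.of R R) => ?_)
  change (koszul a b).d 3 2 ≫ φ = 0
  rw [koszul_d]
  exact Limits.zero_comp

/-- The map from `R` onto the top Ext module `Ext^2 (R ⧸ J, R)` for `J = (a, b)`. -/
def extTop {a b : R} (h : KoszulExact a b) (J : Ideal R) (hJ : J = Ideal.span {a, b}) :
    R →ₗ[R] ((Ext R (ModuleCat.{u} R) 2).obj (Opposite.op (ModuleCat.of R (R ⧸ J)))).obj
      (ModuleCat.of R R) :=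
  ((koszulResolution h J hJ).isoExt 2 (ModuleCat.of R R)).inv.hom ∘ₗ
    (((koszul a b).linearYonedaObj R (ModuleCat.of R R)).classOfNextZero 2
      (koszul_linearYonedaObj_d_two a b)).hom ∘ₗ koszulTopCochain R

lemma extTop_surjective {a b : R} (h : KoszulExact a b) (J : Ideal R)
    (hJ : J = Ideal.span {a, b}) : Function.Surjective (extTop h J hJ) :=
  ((koszulResolution h J hJ).isoExt 2 (ModuleCat.of R R)).toLinearEquiv.symm.surjective.comp
    (((ModuleCat.epi_iff_surjective _).1
      (((koszul a b).linearYonedaObj R (ModuleCat.of R R)).epi_classOfNextZero 2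
        (koszul_linearYonedaObj_d_two a b))).comp koszulTopCochain_surjective)

lemma extTop_eq_zero_iff {a b : R} (h : KoszulExact a b) (J : Ideal R)
    (hJ : J = Ideal.span {a, b}) (r : R) : extTop h J hJ r = 0 ↔ r ∈ J := by
  have h1 := ((koszulResolution h J hJ).isoExt 2 (ModuleCat.of R R)).toLinearEquiv.symm
    |>.map_eq_zero_iff (x := ((koszul a b).linearYonedaObj R (ModuleCat.of R R)).classOfNextZero 2
      (koszul_linearYonedaObj_d_two a b) (koszulTopCochain R r))
  refine h1.trans ((HomologicalComplex.classOfNextZero_eq_zero_iff _ 1 2 (by simp) _ _).trans ?_)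
  rw [hJ, Ideal.mem_span_pair]
  constructor
  · rintro ⟨φ, hφ⟩
    let φ : koszulX R 1 ⟶ ModuleCat.of R R := φ
    have hφ : koszulD a b 1 ≫ φ = koszulTopCochain R r := by
      rw [← koszul_d]
      exact hφ
    let φ' : R × R →ₗ[R] R := φ.hom
    have key : φ' ((b * 1, -(a * 1)) : R × R) = (1 : R) • r :=
      LinearMap.congr_fun (congrArg ModuleCat.Hom.hom hφ) (1 : R)
    refine ⟨-φ' (0, 1), φ' (1, 0), ?_⟩
    have hx : ((b * 1, -(a * 1)) : R × R) = b • (1, 0) + (-a) • (0, 1) := by ext <;> simp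
    rw [hx, map_add, map_smul, map_smul, one_smul, smul_eq_mul, smul_eq_mul] at key
    rw [← key]
    ring
  · rintro ⟨s, t, rfl⟩
    refine ⟨(ModuleCat.ofHom (t • LinearMap.fst R R R - s • LinearMap.snd R R R) :
      koszulX R 1 ⟶ ModuleCat.of R R), ?_⟩
    change (koszul a b).d 2 1 ≫ (ModuleCat.ofHom _ : koszulX R 1 ⟶ ModuleCat.of R R) = _
    · rw [koszul_d]
      refine ModuleCat.hom_ext (LinearMap.ext fun (x : R) => ?_)
      change t * (b * x) - s * (-(a * x)) = x * (s * a + t * b)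
      ring

/-- The components of `koszulMap`. -/
def koszulMapF (c d : R) : ∀ n, koszulX R n ⟶ koszulX R n
  | 0 => 𝟙 _
  | 1 => ModuleCat.ofHom ((c • LinearMap.id).prodMap (d • LinearMap.id))
  | 2 => ModuleCat.ofHom ((c * d) • LinearMap.id)
  | _ + 3 => 0

lemma koszulMapF_comm (a b c d : R) : ∀ n,
    koszulMapF c d (n + 1) ≫ koszulD a b n = koszulD (c * a) (d * b) n ≫ koszulMapF c d n
  | 0 => by
    refine ModuleCat.hom_ext (LinearMap.ext fun (x : R × R) => ?_)
    change a * (c * x.1) + b * (d * x.2) = c * a * x.1 + d * b * x.2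
    ring
  | 1 => by
    refine ModuleCat.hom_ext (LinearMap.ext fun (x : R) => Prod.ext ?_ ?_)
    · change b * (c * d * x) = c * (d * b * x)
      ring
    · change -(a * (c * d * x)) = d * (-(c * a * x))
      ring
  | 2 => by
    refine Eq.trans (Limits.zero_comp) ?_
    exact (Limits.zero_comp).symm
  | _ + 3 => by
    refine Eq.trans (Limits.zero_comp) ?_
    exact (Limits.zero_comp).symm

/-- The chain map of Koszul complexes covering `R ⧸ (c * a, d * b) → R ⧸ (a, b)`. -/
def koszulMap (a b c d : R) : koszul (c * a) (d * b) ⟶ koszul a b :=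
  ChainComplex.ofHom (koszulMapF c d) fun n => by
    rw [koszul_d, koszul_d]
    exact koszulMapF_comm a b c d n

lemma koszulResolution_π_f_zero {a b : R} (h : KoszulExact a b) (J : Ideal R)
    (hJ : J = Ideal.span {a, b}) :
    (koszulResolution h J hJ).π.f 0 = (ModuleCat.ofHom J.mkQ : koszulX R 0 ⟶ _) :=
  ChainComplex.toSingle₀Equiv_symm_apply_f_zero (C := koszul a b) _ _

lemma ext_map_extTop {a b c d a' b' : R} (h : KoszulExact a b) {J J' : Ideal R}
    (hJ : J = Ideal.span {a, b}) (h' : KoszulExact a' b') (hJ' : J' = Ideal.span {a', b'})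
    (ha : a' = c * a) (hb : b' = d * b) (f : ModuleCat.of R (R ⧸ J') ⟶ ModuleCat.of R (R ⧸ J))
    (hf : f.hom ∘ₗ J'.mkQ = J.mkQ) (r : R) :
    ((Ext R (ModuleCat.{u} R) 2).map f.op).app (ModuleCat.of R R) (extTop h J hJ r) =
      extTop h' J' hJ' (c * d * r) := by
  subst ha hb
  have comm : (koszulMap a b c d).f 0 ≫ (koszulResolution h J hJ).π.f 0 =
      (koszulResolution h' J' hJ').π.f 0 ≫ f := by
    rw [koszulResolution_π_f_zero, koszulResolution_π_f_zero]
    refine ModuleCat.hom_ext (LinearMap.ext fun (x : R) => ?_)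
    exact (LinearMap.congr_fun hf x).symm
  have nat := (koszulResolution h' J' hJ').isoExt_hom_naturality f (koszulResolution h J hJ)
    (koszulMap a b c d) comm 2 (ModuleCat.of R R)
  have nat' := HomologicalComplex.classOfNextZero_naturality
    (ChainComplex.linearYonedaMap (koszulMap a b c d) (ModuleCat.of R R)) 2
    (koszul_linearYonedaObj_d_two a b) (koszul_linearYonedaObj_d_two (c * a) (d * b))
  apply ((koszulResolution h' J' hJ').isoExt 2 (ModuleCat.of R R)).toLinearEquiv.injective
  let K := (koszul a b).linearYonedaObj R (ModuleCat.of R R)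
  let e := (koszulResolution h' J' hJ').isoExt (R := R) 2 (ModuleCat.of R R)
  let e₀ := (koszulResolution h J hJ).isoExt (R := R) 2 (ModuleCat.of R R)
  let x := ((koszul a b).linearYonedaObj R (ModuleCat.of R R)).classOfNextZero 2
    (koszul_linearYonedaObj_d_two a b) (koszulTopCochain R r)
  let x' := ((koszul (c * a) (d * b)).linearYonedaObj R (ModuleCat.of R R)).classOfNextZero 2
    (koszul_linearYonedaObj_d_two _ _) (koszulTopCochain R (c * d * r))
  change e.hom (((Ext R (ModuleCat.{u} R) 2).map f.op).app (ModuleCat.of R R) (e₀.inv x)) =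
    e.hom (e.inv x')
  have h1 := congrArg (fun t => t.hom (e₀.inv x)) nat
  refine h1.trans ?_
  have h2 : e₀.hom (e₀.inv x) = x := e₀.toLinearEquiv.apply_symm_apply x
  have h3 : e.hom (e.inv x') = x' := e.toLinearEquiv.apply_symm_apply x'
  rw [h3]
  refine (congrArg (fun t => HomologicalComplex.homologyMap (ChainComplex.linearYonedaMap
    (koszulMap a b c d) (ModuleCat.of R R)) 2 t) h2).trans ?_
  refine (congrArg (fun t => t.hom (koszulTopCochain R r : K.X 2)) nat').trans ?_
  refine congrArg (((koszul (c * a) (d * b)).linearYonedaObj R (ModuleCat.of R R)).classOfNextZero 2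
    (koszul_linearYonedaObj_d_two _ _)) ?_
  refine ModuleCat.hom_ext (LinearMap.ext fun (x : R) => ?_)
  change (c * d * x) * r = x * (c * d * r)
  ring

/-- The descending chain of ideals `(a ^ n, b ^ n)`. -/
def spanPowDiagram (a b : R) : ℕᵒᵖ ⥤ Ideal R where
  obj n := Ideal.span {a ^ n.unop, b ^ n.unop}
  map {m n} w := homOfLE <| by
    have hmn : n.unop ≤ m.unop := leOfHom w.unop
    rw [Ideal.span_le, Set.pair_subset_iff]
    exact ⟨Ideal.mem_of_dvd _ (pow_dvd_pow a hmn) (Ideal.subset_span (by simp)),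
      Ideal.mem_of_dvd _ (pow_dvd_pow b hmn) (Ideal.subset_span (by simp))⟩

lemma span_pair_le_radical_span_pow (a b : R) (n : ℕ) :
    Ideal.span {a, b} ≤ (Ideal.span {a ^ n, b ^ n}).radical := by
  rw [Ideal.span_le, Set.pair_subset_iff]
  exact ⟨⟨n, Ideal.subset_span (by simp)⟩, ⟨n, Ideal.subset_span (by simp)⟩⟩

/-- The ideals `(a ^ n, b ^ n)`, as ideals whose radical contains `(a, b)`. -/
def spanPowToSelfLERadical (a b : R) :
    ℕᵒᵖ ⥤ localCohomology.SelfLERadical (Ideal.span {a, b}) :=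
  ObjectProperty.lift _ (spanPowDiagram a b) fun n => span_pair_le_radical_span_pow a b n.unop

instance initial_spanPowToSelfLERadical (a b : R) : (spanPowToSelfLERadical a b).Initial where
  out J := by
    apply +allowSynthFailures zigzag_isConnected
    · obtain ⟨m, hm⟩ := J.2 (Ideal.subset_span (show a ∈ ({a, b} : Set R) by simp))
      obtain ⟨n, hn⟩ := J.2 (Ideal.subset_span (show b ∈ ({a, b} : Set R) by simp))
      have hk : Ideal.span {a ^ (m + n), b ^ (m + n)} ≤ J.1 := by
        rw [Ideal.span_le, Set.pair_subset_iff]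
        exact ⟨Ideal.mem_of_dvd _ (pow_dvd_pow a (Nat.le_add_right m n)) hm,
          Ideal.mem_of_dvd _ (pow_dvd_pow b (Nat.le_add_left n m)) hn⟩
      exact ⟨CostructuredArrow.mk
        (⟨⟨⟨hk⟩⟩⟩ : (spanPowToSelfLERadical a b).obj (Opposite.op (m + n)) ⟶ J)⟩
    · intro j₁ j₂
      apply Relation.ReflTransGen.single
      rcases le_total j₁.left.unop j₂.left.unop with h | h
      · right
        exact ⟨CostructuredArrow.homMk (homOfLE h).op rfl⟩
      · left
        exact ⟨CostructuredArrow.homMk (homOfLE h).op rfl⟩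

/-- Local cohomology with support in `(a, b)` is computed by the ideals `(a ^ n, b ^ n)`. -/
def localCohomologyIsoSpanPow [IsNoetherianRing R] (a b : R) (i : ℕ) :
    localCohomology.ofDiagram.{u, 0} (spanPowDiagram a b) i ≅
      localCohomology (Ideal.span {a, b}) i :=
  localCohomology.isoOfFinal.{u, u, 0} (spanPowToSelfLERadical a b)
    (localCohomology.selfLERadicalDiagram (Ideal.span {a, b})) i ≪≫
      localCohomology.isoSelfLERadical (Ideal.span {a, b}) i

/-- The structure maps to the direct limit of Ext modules. -/
lemma localCohomology.exists_ofDiagram_maps (I : ℕᵒᵖ ⥤ Ideal R) (i : ℕ) (M : ModuleCat.{u} R) :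
    ∃ ι : ∀ n, ((localCohomology.diagram I i).obj n).obj M →ₗ[R]
        (localCohomology.ofDiagram.{u, 0} I i).obj M,
      (∀ y, ∃ n x, ι n x = y) ∧
      (∀ m n (f : m ⟶ n) x, ι n (((localCohomology.diagram I i).map f).app M x) = ι m x) ∧
      (∀ n x, ι n x = 0 → ∃ m, ∃ f : n ⟶ m, ((localCohomology.diagram I i).map f).app M x = 0) := by
  have := localCohomology.hasColimitDiagram.{u, 0} I i
  have : Limits.PreservesFilteredColimitsOfSize.{0, 0} (forget (ModuleCat.{u} R)) :=
    Limits.preservesSmallestFilteredColimits_of_preservesFilteredColimits _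
  let F := localCohomology.diagram I i
  let c := ((evaluation _ _).obj M).mapCocone (Limits.colimit.cocone F)
  have hc : Limits.IsColimit c :=
    Limits.isColimitOfPreserves ((evaluation _ _).obj M) (Limits.colimit.isColimit F)
  refine ⟨fun n => (c.ι.app n).hom, ?_, ?_, ?_⟩
  · intro y
    exact Limits.Concrete.isColimit_exists_rep _ hc y
  · intro m n f x
    exact congrArg (fun t => t.hom x) (c.w f)
  · intro n x hx
    obtain ⟨m, f, g, hfg⟩ := (Limits.Concrete.isColimit_rep_eq_iff_exists _ hc x
      (0 : (F.obj n).obj M)).1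
      (hx.trans (map_zero (c.ι.app n).hom).symm)
    exact ⟨m, f, hfg.trans (map_zero ((F.map g).app M).hom)⟩

lemma not_dvd_pow_of_prime {a b : R} (ha : Prime a) (hab : ¬ a ∣ b) (n : ℕ) : ¬ a ∣ b ^ n :=
  fun h => hab (ha.dvd_of_dvd_pow h)

lemma koszulExact_pow_of_prime [IsDomain R] {a b : R} (ha : Prime a) (hab : ¬ a ∣ b) (n : ℕ) :
    KoszulExact (a ^ n) (b ^ n) where
  exact_one u v huv := by
    have hdvd : a ^ n ∣ b ^ n * v := ⟨-u, by linear_combination huv⟩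
    obtain ⟨w, rfl⟩ := ha.pow_dvd_of_dvd_mul_left n (not_dvd_pow_of_prime ha hab n) hdvd
    have hu : a ^ n * (u + b ^ n * w) = 0 := by linear_combination huv
    have hu := (mul_eq_zero.1 hu).resolve_left (pow_ne_zero n ha.ne_zero)
    exact ⟨-w, by linear_combination -hu, by ring⟩
  injective r _ hr :=
    (mul_eq_zero.1 (neg_eq_zero.1 hr)).resolve_left (pow_ne_zero n ha.ne_zero)

lemma mem_span_pow_of_mul_pow_mem [IsDomain R] {a b : R} (ha : Prime a) (hb : Prime b)
    (hab : ¬ a ∣ b) (hba : ¬ b ∣ a) (n m : ℕ) (r : R)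
    (hr : a ^ m * b ^ m * r ∈ Ideal.span {a ^ (n + m), b ^ (n + m)}) :
    r ∈ Ideal.span {a ^ n, b ^ n} := by
  rw [Ideal.mem_span_pair] at hr ⊢
  obtain ⟨s, t, hst⟩ := hr
  have ht : a ^ m ∣ b ^ (n + m) * t :=
    ⟨b ^ m * r - s * a ^ n, by rw [pow_add] at *; linear_combination hst⟩
  obtain ⟨t, rfl⟩ := ha.pow_dvd_of_dvd_mul_left m (not_dvd_pow_of_prime ha hab _) ht
  have hs : b ^ m ∣ a ^ (n + m) * s :=
    ⟨a ^ m * r - a ^ m * t * b ^ n, by rw [pow_add] at *; linear_combination hst⟩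
  obtain ⟨s, rfl⟩ := hb.pow_dvd_of_dvd_mul_left m (not_dvd_pow_of_prime hb hba _) hs
  refine ⟨s, t, mul_left_cancel₀ (mul_ne_zero (pow_ne_zero m ha.ne_zero)
    (pow_ne_zero m hb.ne_zero)) ?_⟩
  rw [← hst, pow_add, pow_add]
  ring

/-- A presentation of `H` as the union of the modules `R ⧸ (a ^ n, b ^ n)` along the
multiplication maps by `a * b`. -/
structure IsSpanPowLimit (a b : R) {H : Type*} [AddCommGroup H] [Module R H]
    (e : ℕ → R →ₗ[R] H) : Prop where
  exists_rep : ∀ y, ∃ n r, e n r = y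
  succ : ∀ n r, e (n + 1) (a * b * r) = e n r
  eq_zero_iff : ∀ n r, e n r = 0 ↔ r ∈ Ideal.span {a ^ n, b ^ n}

lemma exists_isSpanPowLimit_localCohomology [IsNoetherianRing R] [IsDomain R] {a b : R}
    (ha : Prime a) (hb : Prime b) (hab : ¬ a ∣ b) (hba : ¬ b ∣ a) :
    ∃ e : ℕ → R →ₗ[R] (localCohomology (Ideal.span {a, b}) 2).obj (ModuleCat.of R R),
      IsSpanPowLimit a b e := by
  obtain ⟨ι, hι, hcomp, hzero⟩ :=
    localCohomology.exists_ofDiagram_maps (spanPowDiagram a b) 2 (ModuleCat.of R R)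
  have hK := koszulExact_pow_of_prime ha hab
  let θ (n : ℕ) := extTop (hK n) ((spanPowDiagram a b).obj (.op n)) rfl
  have hθ (n m : ℕ) (hnm : n ≤ m) (f : Opposite.op (Opposite.op n) ⟶ Opposite.op (Opposite.op m))
      (r : R) :
      ((localCohomology.diagram (spanPowDiagram a b) 2).map f).app (ModuleCat.of R R) (θ n r) =
        θ m (a ^ (m - n) * b ^ (m - n) * r) :=
    ext_map_extTop (hK n) rfl (hK m) rfl (by rw [← pow_add, Nat.sub_add_cancel hnm])
      (by rw [← pow_add, Nat.sub_add_cancel hnm]) _ (LinearMap.ext fun _ => rfl) r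
  let ε := ((localCohomologyIsoSpanPow a b 2).app (ModuleCat.of R R)).toLinearEquiv
  refine ⟨fun n => ε.toLinearMap ∘ₗ ι (.op (.op n)) ∘ₗ θ n, ?_, ?_, ?_⟩
  · intro y
    obtain ⟨⟨⟨n⟩⟩, x, hx⟩ := hι (ε.symm y)
    obtain ⟨r, rfl⟩ := extTop_surjective (hK n) _ rfl x
    exact ⟨n, r, (congrArg ε hx).trans (ε.apply_symm_apply y)⟩
  · intro n r
    have h := hθ n (n + 1) n.le_succ (homOfLE n.le_succ).op.op r
    rw [Nat.add_sub_cancel_left, pow_one, pow_one] at h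
    exact congrArg ε ((congrArg (ι _) h.symm).trans (hcomp _ _ _ _))
  · intro n r
    refine (ε.map_eq_zero_iff).trans ⟨fun h => ?_, fun h => ?_⟩
    · obtain ⟨⟨⟨m⟩⟩, f, hf⟩ := hzero _ _ h
      have hnm : n ≤ m := leOfHom f.unop.unop
      have hm := (extTop_eq_zero_iff (hK m) _ rfl _).1 ((hθ n m hnm f r).symm.trans hf)
      obtain ⟨m, rfl⟩ := Nat.exists_eq_add_of_le hnm
      rw [Nat.add_sub_cancel_left] at hm
      exact mem_span_pow_of_mul_pow_mem ha hb hab hba n m r hm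
    · have h0 : θ n r = 0 := (extTop_eq_zero_iff (hK n) _ rfl r).2 h
      exact (congrArg (ι (.op (.op n))) h0).trans (ι (.op (.op n))).map_zero

namespace IsSpanPowLimit

variable {a b : R} {H : Type*} [AddCommGroup H] [Module R H] {e : ℕ → R →ₗ[R] H}

lemma add (he : IsSpanPowLimit a b e) (n m : ℕ) (r : R) :
    e (n + m) (a ^ m * b ^ m * r) = e n r := by
  induction m with
  | zero => simp
  | succ m ih =>
    rw [← ih, ← he.succ (n + m), ← add_assoc]
    congr 1
    ring

lemma exists_rep_succ (he : IsSpanPowLimit a b e) (y : H) : ∃ n r, e (n + 1) r = y := by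
  obtain ⟨n, r, rfl⟩ := he.exists_rep y
  exact ⟨n, a * b * r, he.succ n r⟩

lemma exists_smul_eq (he : IsSpanPowLimit a b e) (y : H) : ∃ y', a • y' = y := by
  obtain ⟨n, r, rfl⟩ := he.exists_rep y
  exact ⟨e (n + 1) (b * r), by rw [← he.succ n, ← map_smul, smul_eq_mul, mul_assoc]⟩

lemma eq_zero_of_mem (he : IsSpanPowLimit a b e) (n : ℕ) (s t : R) :
    e n (s * a ^ n + t * b ^ n) = 0 :=
  (he.eq_zero_iff n _).2 (Ideal.mem_span_pair.2 ⟨s, t, rfl⟩)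

lemma exists_pow_smul_eq_zero (he : IsSpanPowLimit a b e) (y : H) :
    ∃ n, a ^ n • y = 0 ∧ b ^ n • y = 0 := by
  obtain ⟨n, r, rfl⟩ := he.exists_rep y
  refine ⟨n, ?_, ?_⟩
  · rw [← map_smul, smul_eq_mul, ← he.eq_zero_of_mem n r 0]
    congr 1
    ring
  · rw [← map_smul, smul_eq_mul, ← he.eq_zero_of_mem n 0 r]
    congr 1
    ring

lemma exists_rep_of_smul_eq_zero [IsDomain R] (he : IsSpanPowLimit a b e) (ha : Prime a)
    (hab : ¬ a ∣ b) (y : H) (hy : a • y = 0) : ∃ n s, e (n + 1) (s * a ^ n) = y := by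
  obtain ⟨n, r, rfl⟩ := he.exists_rep_succ y
  rw [← map_smul, smul_eq_mul, he.eq_zero_iff, Ideal.mem_span_pair] at hy
  obtain ⟨s, t, hst⟩ := hy
  have ht : a ∣ b ^ (n + 1) * t := ⟨r - s * a ^ n, by linear_combination hst⟩
  obtain ⟨t, rfl⟩ := (ha.dvd_or_dvd ht).resolve_left (not_dvd_pow_of_prime ha hab _)
  have hr : r = s * a ^ n + (0 * a ^ (n + 1) + t * b ^ (n + 1)) :=
    mul_left_cancel₀ ha.ne_zero (by linear_combination -hst)
  exact ⟨n, s, by rw [hr, map_add, he.eq_zero_of_mem, add_zero]⟩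

lemma exists_smul_eq_of_smul_eq_zero [IsDomain R] (he : IsSpanPowLimit a b e) (ha : Prime a)
    (hab : ¬ a ∣ b) (y : H) (hy : a • y = 0) : ∃ y', a • y' = 0 ∧ b • y' = y := by
  obtain ⟨n, s, rfl⟩ := he.exists_rep_of_smul_eq_zero ha hab y hy
  refine ⟨e (n + 2) (s * a ^ (n + 1)), ?_, ?_⟩
  · rw [← map_smul, smul_eq_mul, ← he.eq_zero_of_mem (n + 2) s 0]
    congr 1
    ring
  · rw [← map_smul, smul_eq_mul, ← he.succ (n + 1)]
    congr 1
    ring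

lemma mem_span_of_smul_eq_zero [IsDomain R] (he : IsSpanPowLimit a b e) (ha : Prime a)
    (hb : Prime b) (hab : ¬ a ∣ b) (hba : ¬ b ∣ a) (y : H) (hay : a • y = 0) (hby : b • y = 0) :
    y ∈ Submodule.span R {e 1 1} := by
  obtain ⟨n, s, rfl⟩ := he.exists_rep_of_smul_eq_zero ha hab y hay
  rw [← map_smul, smul_eq_mul, he.eq_zero_iff, Ideal.mem_span_pair] at hby
  obtain ⟨u, t, hst⟩ := hby
  have ht : a ^ n ∣ b ^ (n + 1) * t := ⟨b * s - a * u, by linear_combination hst⟩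
  obtain ⟨q, rfl⟩ := ha.pow_dvd_of_dvd_mul_left n (not_dvd_pow_of_prime ha hab _) ht
  have hq : b * s - a * u = q * b ^ (n + 1) :=
    mul_left_cancel₀ (pow_ne_zero n ha.ne_zero) (by linear_combination -hst)
  have hu : b ∣ a * u := ⟨s - q * b ^ n, by linear_combination -hq⟩
  obtain ⟨p, rfl⟩ := (hb.dvd_or_dvd hu).resolve_left hba
  have hs : s = a * p + q * b ^ n := mul_left_cancel₀ hb.ne_zero (by linear_combination hq)
  refine Submodule.mem_span_singleton.2 ⟨q, ?_⟩
  have hsum : s * a ^ n =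
      q • (a ^ n * b ^ n * 1) + (p * a ^ (n + 1) + 0 * b ^ (n + 1)) := by
    rw [hs, smul_eq_mul]
    ring
  rw [hsum, map_add, he.eq_zero_of_mem, add_zero, map_smul, ← he.add 1 n, add_comm 1 n]

lemma support_eq (he : IsSpanPowLimit a b e) :
    Module.support R H = PrimeSpectrum.zeroLocus (Ideal.span {a, b} : Ideal R) := by
  ext p
  rw [Module.mem_support_iff_exists_annihilator, PrimeSpectrum.mem_zeroLocus,
    SetLike.coe_subset_coe]
  constructor
  · rintro ⟨y, hy⟩
    obtain ⟨n, hn, hn'⟩ := he.exists_pow_smul_eq_zero y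
    rw [Ideal.span_le, Set.pair_subset_iff]
    exact ⟨p.2.mem_of_pow_mem n (hy ((Submodule.mem_annihilator_span_singleton _ _).2 hn)),
      p.2.mem_of_pow_mem n (hy ((Submodule.mem_annihilator_span_singleton _ _).2 hn'))⟩
  · intro hp
    refine ⟨e 1 1, fun r hr => hp ?_⟩
    rw [Submodule.mem_annihilator_span_singleton, ← map_smul, smul_eq_mul, mul_one,
      he.eq_zero_iff, pow_one, pow_one] at hr
    exact hr

end IsSpanPowLimit

end Koszul

namespace PowerSeries

variable {A : Type*} [CommRing A]

lemma ker_constantCoeff_eq_span_X :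
    RingHom.ker (constantCoeff (R := A)) = Ideal.span {(X : PowerSeries A)} := by
  ext f
  rw [RingHom.mem_ker, Ideal.mem_span_singleton, X_dvd_iff]

lemma ringKrullDim_eq_add_one [IsNoetherianRing A] [IsLocalRing A] :
    ringKrullDim (PowerSeries A) = ringKrullDim A + 1 := by
  have hreg : IsSMulRegular (PowerSeries A) (X : PowerSeries A) := fun f g hfg =>
    X_mul_cancel hfg
  have hmem : (X : PowerSeries A) ∈ IsLocalRing.maximalIdeal (PowerSeries A) := by
    rw [IsLocalRing.mem_maximalIdeal, mem_nonunits_iff, isUnit_iff_constantCoeff]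
    simp
  rw [← ringKrullDim_quotient_span_singleton_succ_eq_ringKrullDim hreg hmem,
    ← ker_constantCoeff_eq_span_X]
  exact congrArg (· + 1) (ringKrullDim_eq_of_ringEquiv
    (RingHom.quotientKerEquivOfSurjective constantCoeff_surj))

end PowerSeries

namespace MvPowerSeries

lemma ringKrullDim_fin_field (k : Type*) [Field k] (n : ℕ) :
    ringKrullDim (MvPowerSeries (Fin n) k) = n := by
  induction n with
  | zero =>
    rw [ringKrullDim_eq_of_ringEquiv (isEmptyEquiv (Fin 0) k).toRingEquiv]
    simp
  | succ n ih =>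
    rw [ringKrullDim_eq_of_ringEquiv (finSuccEquiv k n).toRingEquiv,
      PowerSeries.ringKrullDim_eq_add_one, ih]
    norm_cast

variable {σ τ R : Type*} [CommRing R]

lemma killCompl_eq_zero_iff (e : σ ↪ τ) (p : MvPowerSeries τ R) :
    killCompl e p = 0 ↔ ∀ m : τ →₀ ℕ, (∀ i ∉ Set.range e, m i = 0) → coeff m p = 0 := by
  constructor
  · intro h m hm
    have hm' : (m.support : Set τ) ⊆ Set.range e := fun i hi => by
      by_contra hie
      exact (Finsupp.mem_support_iff.1 hi) (hm i hie)
    obtain ⟨x, rfl⟩ := (Finsupp.mem_range_embDomain_iff e m).2 hm'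
    rw [← coeff_killCompl, h, map_zero]
  · intro h
    ext x
    rw [coeff_killCompl, map_zero]
    exact h _ fun i hi => Finsupp.embDomain_of_notMem_range e x i hi

lemma killCompl_surjective (e : σ ↪ τ) :
    Function.Surjective (killCompl (R := R) e) := fun p => ⟨_, killCompl_rename_app p⟩

lemma prime_X [IsDomain R] (s : τ) : Prime (X s : MvPowerSeries τ R) := by
  let e : {i // i ≠ s} ↪ τ := Function.Embedding.subtype _
  have h (p : MvPowerSeries τ R) : X s ∣ p ↔ killCompl e p = 0 := by
    rw [X_dvd_iff, killCompl_eq_zero_iff]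
    simp [e]
  refine ⟨?_, ?_, fun p q hpq => ?_⟩
  · intro hX
    have := congrArg (coeff (Finsupp.single s 1)) hX
    simp at this
  · intro hu
    have := (h 1).1 hu.dvd
    simp at this
  · rw [h, map_mul, mul_eq_zero] at hpq
    rwa [h, h]

lemma not_X_dvd_X [Nontrivial R] {s t : τ} (hst : s ≠ t) :
    ¬ (X s : MvPowerSeries τ R) ∣ X t := by
  classical
  rw [X_dvd_iff]
  intro h
  have := h (Finsupp.single t 1) (by simp [hst])
  rw [coeff_X] at this
  simp at this

lemma ker_killCompl_eq_span_pair (e : σ ↪ τ) (s t : τ) (hst : (Set.range e)ᶜ = {s, t}) :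
    RingHom.ker (killCompl (R := R) e) = Ideal.span {X s, X t} := by
  classical
  have hi (i : τ) : i ∉ Set.range e ↔ i = s ∨ i = t := by
    rw [← Set.mem_compl_iff, hst]
    rfl
  ext p
  rw [RingHom.mem_ker, killCompl_eq_zero_iff]
  constructor
  · intro h
    let q : MvPowerSeries τ R := fun m => if m s = 0 then 0 else coeff m p
    have hq (m : τ →₀ ℕ) : coeff m q = if m s = 0 then 0 else coeff m p := rfl
    have hqs : X s ∣ q := by
      rw [X_dvd_iff]
      intro m hm
      rw [hq, if_pos hm]
    have hqt : X t ∣ p - q := by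
      rw [X_dvd_iff]
      intro m hm
      rw [map_sub, hq]
      split_ifs with hs
      · rw [sub_zero]
        refine h m fun i hie => ?_
        rcases (hi i).1 hie with rfl | rfl <;> assumption
      · exact sub_self _
    rw [← add_sub_cancel q p]
    exact Ideal.add_mem _ (Ideal.mem_of_dvd _ hqs (Ideal.subset_span (by simp)))
      (Ideal.mem_of_dvd _ hqt (Ideal.subset_span (by simp)))
  · intro h m hm
    obtain ⟨u, v, rfl⟩ := Ideal.mem_span_pair.1 h
    rw [map_add, X_dvd_iff.1 (dvd_mul_left _ _) m (hm s ((hi s).2 (.inl rfl))),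
      X_dvd_iff.1 (dvd_mul_left _ _) m (hm t ((hi t).2 (.inr rfl))), add_zero]

end MvPowerSeries

/-- If `Supp M = V(J)` for a prime ideal `J`, then `dim M = dim R ⧸ J`. -/
lemma moduleDim_eq_of_support_eq {R : Type} [CommRing R] {M : Type} [AddCommGroup M] [Module R M]
    (J : Ideal R) [hJ : J.IsPrime] (h : Module.support R M = PrimeSpectrum.zeroLocus J) :
    moduleDim R M = ringKrullDim (R ⧸ J) := by
  refine le_antisymm (iSup₂_le fun p hp => ?_) ?_
  · rw [h, PrimeSpectrum.mem_zeroLocus, SetLike.coe_subset_coe] at hp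
    exact ringKrullDim_le_of_surjective (Ideal.Quotient.factor hp)
      (Ideal.Quotient.factor_surjective hp)
  · refine le_iSup₂_of_le (⟨J, hJ⟩ : PrimeSpectrum R) ?_ le_rfl
    rw [h, PrimeSpectrum.mem_zeroLocus]

lemma support_quotient_eq_zeroLocus {R : Type} [CommRing R] (J : Ideal R) :
    Module.support R (R ⧸ J) = PrimeSpectrum.zeroLocus (J : Set R) := by
  rw [Module.support_eq_zeroLocus, Ideal.annihilator_quotient]

/-- Let `R = k[[x,y,z,w]]` and `I = (x,z)`. Then `H^2_I(R)` is `I`-cofinite,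
`Supp H^2_I(R) = Supp R/I`, and `dim H^2_I(R) = 2`. -/
theorem localCohomology_two_powerSeries (k : Type) [Field k] :
    IsCofinite (MvPowerSeries (Fin 4) k)
        (Ideal.span {(MvPowerSeries.X 0 : MvPowerSeries (Fin 4) k),
          (MvPowerSeries.X 2 : MvPowerSeries (Fin 4) k)})
        ((localCohomology
            (Ideal.span {(MvPowerSeries.X 0 : MvPowerSeries (Fin 4) k),
              (MvPowerSeries.X 2 : MvPowerSeries (Fin 4) k)}) 2).obj
          (ModuleCat.of (MvPowerSeries (Fin 4) k) (MvPowerSeries (Fin 4) k))) ∧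
      Module.support (MvPowerSeries (Fin 4) k)
          ((localCohomology
              (Ideal.span {(MvPowerSeries.X 0 : MvPowerSeries (Fin 4) k),
                (MvPowerSeries.X 2 : MvPowerSeries (Fin 4) k)}) 2).obj
            (ModuleCat.of (MvPowerSeries (Fin 4) k) (MvPowerSeries (Fin 4) k))) =
        Module.support (MvPowerSeries (Fin 4) k)
          (MvPowerSeries (Fin 4) k ⧸
            Ideal.span {(MvPowerSeries.X 0 : MvPowerSeries (Fin 4) k),
              (MvPowerSeries.X 2 : MvPowerSeries (Fin 4) k)}) ∧
      moduleDim (MvPowerSeries (Fin 4) k)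
          ((localCohomology
              (Ideal.span {(MvPowerSeries.X 0 : MvPowerSeries (Fin 4) k),
                (MvPowerSeries.X 2 : MvPowerSeries (Fin 4) k)}) 2).obj
            (ModuleCat.of (MvPowerSeries (Fin 4) k) (MvPowerSeries (Fin 4) k))) = 2 := by
  have ha : Prime (MvPowerSeries.X 0 : MvPowerSeries (Fin 4) k) := MvPowerSeries.prime_X 0
  have hb : Prime (MvPowerSeries.X 2 : MvPowerSeries (Fin 4) k) := MvPowerSeries.prime_X 2
  have hab : ¬ (MvPowerSeries.X 0 : MvPowerSeries (Fin 4) k) ∣ MvPowerSeries.X 2 :=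
    MvPowerSeries.not_X_dvd_X (by decide)
  have hba : ¬ (MvPowerSeries.X 2 : MvPowerSeries (Fin 4) k) ∣ MvPowerSeries.X 0 :=
    MvPowerSeries.not_X_dvd_X (by decide)
  have : IsDomain (MvPowerSeries (Fin 4) k) := NoZeroDivisors.to_isDomain _
  obtain ⟨e, he⟩ := exists_isSpanPowLimit_localCohomology ha hb hab hba
  have hexact := koszulExact_pow_of_prime ha hab 1
  rw [pow_one, pow_one] at hexact
  let i : Fin 2 ↪ Fin 4 := ⟨![1, 3], by decide⟩
  have hker := MvPowerSeries.ker_killCompl_eq_span_pair (R := k) i 0 2 (by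
    ext j
    fin_cases j <;> simp [i])
  have : IsDomain (MvPowerSeries (Fin 2) k) := NoZeroDivisors.to_isDomain _
  have hprime : (Ideal.span {(MvPowerSeries.X 0 : MvPowerSeries (Fin 4) k),
      (MvPowerSeries.X 2 : MvPowerSeries (Fin 4) k)}).IsPrime :=
    hker ▸ RingHom.ker_isPrime _
  refine ⟨⟨he.support_eq.subset, fun n => ?_⟩,
    he.support_eq.trans (support_quotient_eq_zeroLocus _).symm, ?_⟩
  · exact finite_ext_of_koszulExact hexact rfl _ he.exists_smul_eq
      (he.exists_smul_eq_of_smul_eq_zero ha hab) (Submodule.span _ {e 1 1})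
      (he.mem_span_of_smul_eq_zero ha hb hab hba) n
  · rw [moduleDim_eq_of_support_eq _ he.support_eq, ← hker]
    exact (ringKrullDim_eq_of_ringEquiv (RingHom.quotientKerEquivOfSurjective
      (MvPowerSeries.killCompl_surjective i))).trans (MvPowerSeries.ringKrullDim_fin_field k 2)
end
end
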